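/- Let n ≥ 2, let R be a proper n-system, and let δ > 0 and ε > 0. Then there exists a self-similar rigid n-system S of mesh δ such that dist(F(R), F(S)) ≤ ε. -/

import Mathlib

open Filter Set Pointwise Topology

noncomputable section

/-- Points of `ℝ^n`. -/
abbrev RVec (n : ℕ) := Fin n → ℝ

/-- The vector of `ℝ^n` with a `1` in position `j` (0-based) and `0` elsewhere;
`eVec n 0` is the first canonical basis vector `e_1`. -/
def eVec (n : ℕ) (j : ℕ) : RVec n := fun i => if (i : ℕ) = j then 1 else 0

/-- `P` is an `n`-system on the subinterval `I` of `[0,∞)`: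
`I` is an order-connected subset of `[0,∞)` with nonempty interior, and conditions
(S1), (S2), (S3) hold at every `q ∈ I`. -/
def IsNSystem (n : ℕ) (I : Set ℝ) (P : ℝ → RVec n) : Prop :=
  I ⊆ Set.Ici (0 : ℝ) ∧ I.OrdConnected ∧ (interior I).Nonempty ∧
  ∀ q ∈ I,
    ((∀ i, 0 ≤ P q i) ∧ Monotone (P q) ∧ (∑ i, P q i) = q) ∧
    ∃ ε > (0 : ℝ), ∃ k ℓ : Fin n,
      (∀ t ∈ I ∩ Set.Icc (q - ε) q, P t = P q + (t - q) • eVec n ℓ) ∧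
      (∀ t ∈ I ∩ Set.Icc q (q + ε), P t = P q + (t - q) • eVec n k) ∧
      (q ∈ interior I → ℓ < k → ∀ i : Fin n, ℓ ≤ i → i ≤ k → P q i = P q ℓ)

/-- `P` is a proper `n`-system on `I`: it is an `n`-system whose first component is
unbounded (by the monotonicity (S1) of the components, this is equivalent to all
components simultaneously exceeding any given bound). -/
def IsProperSys (n : ℕ) (I : Set ℝ) (P : ℝ → RVec n) : Prop :=
  IsNSystem n I P ∧ ∀ M : ℝ, ∃ q ∈ I, ∀ i, M < P q i

/-- The set `F(P)` of limits of `q_i⁻¹ • P(q_i)` along strictly increasing unbounded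
sequences `(q_i)` in `I`. -/
def FSet (n : ℕ) (I : Set ℝ) (P : ℝ → RVec n) : Set (RVec n) :=
  {x | ∃ q : ℕ → ℝ, (∀ i, q i ∈ I) ∧ StrictMono q ∧
    Tendsto q atTop atTop ∧ Tendsto (fun i => (q i)⁻¹ • P (q i)) atTop (𝓝 x)}

/-- The set `F(P, e₁)`: as `F(P)`, but with the extra requirement that the right
derivative of `P` at each `q_i` is the first basis vector `e_1`. -/
def FSetE1 (n : ℕ) (I : Set ℝ) (P : ℝ → RVec n) : Set (RVec n) :=
  {x | ∃ q : ℕ → ℝ, (∀ i, q i ∈ I) ∧ StrictMono q ∧ Tendsto q atTop atTop ∧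
    (∀ i, ∃ ε > (0 : ℝ), ∀ t ∈ I ∩ Set.Icc (q i) (q i + ε),
      P t = P (q i) + (t - q i) • eVec n 0) ∧
    Tendsto (fun i => (q i)⁻¹ • P (q i)) atTop (𝓝 x)}

/-- `q` is a switch number of the `n`-system `P` on `I`: a point of `I` on the boundary
of `I`, or an interior point where the local slopes `e_k` (right) and `e_ℓ` (left)
from (S2) satisfy `k < ℓ`. -/
def IsSwitchNumber (n : ℕ) (I : Set ℝ) (P : ℝ → RVec n) (q : ℝ) : Prop :=
  q ∈ I ∧ (q ∈ frontier I ∨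
    (q ∈ interior I ∧ ∃ ε > (0 : ℝ), ∃ k ℓ : Fin n, k < ℓ ∧
      (∀ t ∈ I ∩ Set.Icc (q - ε) q, P t = P q + (t - q) • eVec n ℓ) ∧
      (∀ t ∈ I ∩ Set.Icc q (q + ε), P t = P q + (t - q) • eVec n k)))

/-- `q` is a division number of the `n`-system `P` on `I`: a point of `I` on the boundary
of `I`, or an interior point where `P` is not differentiable, i.e. where the left and
right slopes from (S2) differ. -/
def IsDivisionNumber (n : ℕ) (I : Set ℝ) (P : ℝ → RVec n) (q : ℝ) : Prop :=
  q ∈ I ∧ (q ∈ frontier I ∨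
    (q ∈ interior I ∧ ∃ ε > (0 : ℝ), ∃ k ℓ : Fin n, k ≠ ℓ ∧
      (∀ t ∈ I ∩ Set.Icc (q - ε) q, P t = P q + (t - q) • eVec n ℓ) ∧
      (∀ t ∈ I ∩ Set.Icc q (q + ε), P t = P q + (t - q) • eVec n k)))

/-- A non-degenerate `n`-system: an `n`-system whose domain is a closed subinterval
of `(0,∞)` and whose switch points all have `n` distinct positive coordinates. -/
def IsNonDegenerate (n : ℕ) (I : Set ℝ) (P : ℝ → RVec n) : Prop :=
  IsNSystem n I P ∧ IsClosed I ∧ I ⊆ Set.Ioi (0 : ℝ) ∧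
  ∀ q, IsSwitchNumber n I P q → (∀ i, 0 < P q i) ∧ StrictMono (P q)

/-- A rigid `n`-system of mesh `δ`: a non-degenerate `n`-system whose switch points
belong to `δℤ^n`. -/
def IsRigid (n : ℕ) (δ : ℝ) (I : Set ℝ) (P : ℝ → RVec n) : Prop :=
  IsNonDegenerate n I P ∧
  ∀ q, IsSwitchNumber n I P q → ∀ i, ∃ m : ℤ, P q i = δ * m

/-- A self-similar system: the domain is unbounded and there is `ρ > 1` with
`P(ρq) = ρ • P(q)` for all `q` in the domain. -/
def IsSelfSimilar (n : ℕ) (I : Set ℝ) (P : ℝ → RVec n) : Prop :=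
  ¬ BddAbove I ∧ ∃ ρ : ℝ, 1 < ρ ∧ ∀ q ∈ I, ρ * q ∈ I ∧ P (ρ * q) = ρ • P q

/-- The cube `[-ε, ε]^n`. -/
def cubeNbhd (n : ℕ) (ε : ℝ) : Set (RVec n) := {y | ∀ i, |y i| ≤ ε}

/-- The distance `dist(E, F)`: the infimum of all `ε > 0` such that
`E ⊆ F + [-ε,ε]^n` and `F ⊆ E + [-ε,ε]^n`. -/
def cubeDist (n : ℕ) (E F : Set (RVec n)) : ℝ :=
  sInf {ε : ℝ | 0 < ε ∧ E ⊆ F + cubeNbhd n ε ∧ F ⊆ E + cubeNbhd n ε}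

/-- `μ_T(P)`: the point of `ℝ^m` whose `j`-th coordinate is
`liminf_{q → ∞, q ∈ I} T_j(P(q))/q`. -/
def muT (n m : ℕ) (T : RVec n → RVec m) (I : Set ℝ) (P : ℝ → RVec n) : RVec m :=
  fun j => Filter.liminf (fun q => T (P q) j / q) (atTop ⊓ 𝓟 I)

/-- `liminf` of a sequence of subsets of `ℝ^n`: the set of limits of convergent
sequences `(x_i)` with `x_i ∈ F i` for every `i`. -/
def setLiminf (n : ℕ) (F : ℕ → Set (RVec n)) : Set (RVec n) :=
  {x | ∃ y : ℕ → RVec n, (∀ i, y i ∈ F i) ∧ Tendsto y atTop (𝓝 x)}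

/-- `limsup` of a sequence of subsets of `ℝ^n`: the set of accumulation points of
sequences `(x_i)` with `x_i ∈ F i` for every `i`, i.e. limits of convergent
subsequences. -/
def setLimsup (n : ℕ) (F : ℕ → Set (RVec n)) : Set (RVec n) :=
  {x | ∃ (y : ℕ → RVec n) (φ : ℕ → ℕ), (∀ i, y i ∈ F i) ∧ StrictMono φ ∧
    Tendsto (y ∘ φ) atTop (𝓝 x)}

/-- A positive, lattice valued point `x.1` reached with slope index `x.2` is followed by a linear
move in the direction of index `y.2`, staying in `C` and ending at `y.1`; the transition of slopes
at `x.1` obeys the rules of a non-degenerate `n`-system. -/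
def IsMove (n : ℕ) (C : Set (RVec n)) (Λ : Set ℝ) (x y : RVec n × Fin n) : Prop :=
  (∀ j, 0 < x.1 j) ∧ (∀ j, x.1 j ∈ Λ) ∧ Monotone x.1 ∧ Monotone y.1 ∧
  (∃ d > (0 : ℝ), y.1 = x.1 + d • eVec n y.2 ∧
    ∀ τ ∈ Set.Icc (0 : ℝ) d, x.1 + τ • eVec n y.2 ∈ C) ∧
  (x.2 < y.2 → ∀ i, x.2 ≤ i → i ≤ y.2 → x.1 i = x.1 x.2) ∧
  (y.2 < x.2 → StrictMono x.1)

section Polyline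

variable {n : ℕ}

lemma eVec_apply (k i : Fin n) : eVec n k i = if i = k then 1 else 0 := by
  simp [eVec, Fin.ext_iff]

lemma sum_eVec (k : Fin n) : ∑ i, eVec n k i = 1 := by
  simp [eVec_apply]

lemma sum_add_smul_eVec (x : RVec n) (τ : ℝ) (k : Fin n) :
    ∑ i, (x + τ • eVec n k) i = (∑ i, x i) + τ := by
  simp [Finset.sum_add_distrib, ← Finset.mul_sum, sum_eVec]

lemma eVec_inj_of_smul {τ : ℝ} (hτ : τ ≠ 0) {k l : Fin n}
    (h : τ • eVec n k = τ • eVec n l) : k = l := by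
  have h1 := congrFun h k
  by_contra hkl
  simp [eVec_apply, hkl, hτ] at h1

/-- The index of the segment of a polygonal line containing the time `t`. -/
def polyIdx (q : ℕ → ℝ) (t : ℝ) : ℕ := sInf {i | t < q (i + 1)}

/-- The polygonal line with vertices `A i` reached with slope index `L i`, parametrized by the
sum of the coordinates. -/
def polyLine (A : ℕ → RVec n) (L : ℕ → Fin n) (t : ℝ) : RVec n :=
  A (polyIdx (fun i => ∑ j, A i j) t) +
    (t - ∑ j, A (polyIdx (fun i => ∑ j, A i j) t) j) •
      eVec n (L (polyIdx (fun i => ∑ j, A i j) t + 1))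

lemma polyIdx_eq {q : ℕ → ℝ} (hq : StrictMono q) {i : ℕ} {t : ℝ} (h1 : q i ≤ t)
    (h2 : t < q (i + 1)) : polyIdx q t = i := by
  refine le_antisymm (Nat.sInf_le h2) ?_
  by_contra! hlt
  have hmem : polyIdx q t ∈ {i | t < q (i + 1)} := Nat.sInf_mem ⟨i, h2⟩
  have : q (polyIdx q t + 1) ≤ q i := hq.monotone hlt
  have h3 : t < q (polyIdx q t + 1) := hmem
  linarith

lemma exists_segment {q : ℕ → ℝ} (hq' : Tendsto q atTop atTop) {t : ℝ}
    (ht : q 0 ≤ t) : ∃ i, q i ≤ t ∧ t < q (i + 1) := by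
  classical
  have hex : ∃ i, t < q i := (hq'.eventually_gt_atTop t).exists
  obtain ⟨i, hi⟩ : ∃ i, Nat.find hex = i + 1 := by
    refine Nat.exists_eq_succ_of_ne_zero fun h0 => ?_
    have := Nat.find_spec hex
    rw [h0] at this
    linarith
  refine ⟨i, not_lt.1 (Nat.find_min hex (by omega)), ?_⟩
  rw [← hi]
  exact Nat.find_spec hex

variable {C : Set (RVec n)} {Λ : Set ℝ} {A : ℕ → RVec n} {L : ℕ → Fin n}

lemma IsMove.sum_lt {x y : RVec n × Fin n} (h : IsMove n C Λ x y) :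
    ∑ j, x.1 j < ∑ j, y.1 j := by
  obtain ⟨-, -, -, -, ⟨d, hd, he, -⟩, -⟩ := h
  rw [he, sum_add_smul_eVec]
  linarith

lemma IsMove.eq_add {x y : RVec n × Fin n} (h : IsMove n C Λ x y) :
    y.1 = x.1 + (∑ j, y.1 j - ∑ j, x.1 j) • eVec n y.2 := by
  obtain ⟨-, -, -, -, ⟨d, hd, he, -⟩, -⟩ := h
  rw [he, sum_add_smul_eVec]
  simp

lemma IsMove.mem {x y : RVec n × Fin n} (h : IsMove n C Λ x y) {τ : ℝ} (h0 : 0 ≤ τ)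
    (h1 : τ ≤ ∑ j, y.1 j - ∑ j, x.1 j) : x.1 + τ • eVec n y.2 ∈ C := by
  obtain ⟨-, -, -, -, ⟨d, hd, he, hC⟩, -⟩ := h
  refine hC τ ⟨h0, ?_⟩
  rw [he, sum_add_smul_eVec] at h1
  linarith

/-- Points on the segment of a move are monotone. -/
lemma IsMove.monotone_segment {x y : RVec n × Fin n} (h : IsMove n C Λ x y) {τ : ℝ} (h0 : 0 ≤ τ)
    (h1 : τ ≤ ∑ j, y.1 j - ∑ j, x.1 j) : Monotone (x.1 + τ • eVec n y.2) := by
  have he := h.eq_add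
  obtain ⟨-, -, hx, hy, -⟩ := h
  set d := ∑ j, y.1 j - ∑ j, x.1 j
  intro i j hij
  have h2 := hx hij
  have h3 := hy hij
  rw [he] at h3
  simp only [Pi.add_apply, Pi.smul_apply, eVec_apply, smul_eq_mul] at h3 ⊢
  split_ifs at h3 ⊢ <;> linarith

section

variable (hM : ∀ i, IsMove n C Λ (A i, L i) (A (i + 1), L (i + 1)))
  (hq' : Tendsto (fun i => ∑ j, A i j) atTop atTop)

include hM in
lemma strictMono_sum : StrictMono (fun i => ∑ j, A i j) :=
  strictMono_nat_of_lt_succ fun i => (hM i).sum_lt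

include hM in
lemma polyLine_eq (i : ℕ) {t : ℝ} (h1 : ∑ j, A i j ≤ t) (h2 : t ≤ ∑ j, A (i + 1) j) :
    polyLine A L t = A i + (t - ∑ j, A i j) • eVec n (L (i + 1)) := by
  rcases h2.lt_or_eq with h2 | h2
  · rw [polyLine, polyIdx_eq (strictMono_sum hM) h1 h2]
  · rw [polyLine, polyIdx_eq (strictMono_sum hM) (i := i + 1) h2.ge
      (h2.trans_lt (hM (i + 1)).sum_lt), h2, sub_self, zero_smul, add_zero]
    exact (hM i).eq_add

include hM in
lemma polyLine_vertex (i : ℕ) : polyLine A L (∑ j, A i j) = A i := by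
  rw [polyLine_eq hM i le_rfl (hM i).sum_lt.le]
  simp

include hM hq' in
lemma polyLine_right {t : ℝ} (ht : ∑ j, A 0 j ≤ t) :
    ∃ i, ∑ j, A i j ≤ t ∧ t < ∑ j, A (i + 1) j ∧
      ∀ u ∈ Set.Icc t (∑ j, A (i + 1) j),
        polyLine A L u = polyLine A L t + (u - t) • eVec n (L (i + 1)) := by
  obtain ⟨i, h1, h2⟩ := exists_segment hq' ht
  refine ⟨i, h1, h2, fun u hu => ?_⟩
  rw [polyLine_eq hM i (h1.trans hu.1) hu.2, polyLine_eq hM i h1 h2.le, add_assoc, ← add_smul]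
  congr 2
  ring

include hM hq' in
lemma polyLine_left {t : ℝ} (ht : ∑ j, A 0 j < t) :
    ∃ i, ∑ j, A i j < t ∧ t ≤ ∑ j, A (i + 1) j ∧
      ∀ u ∈ Set.Icc (∑ j, A i j) t,
        polyLine A L u = polyLine A L t + (u - t) • eVec n (L (i + 1)) := by
  obtain ⟨i, h1, h2⟩ : ∃ i, ∑ j, A i j < t ∧ t ≤ ∑ j, A (i + 1) j := by
    obtain ⟨i, h1, h2⟩ := exists_segment hq' ht.le
    rcases h1.lt_or_eq with h1 | h1
    · exact ⟨i, h1, h2.le⟩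
    · obtain _ | i := i
      · exact absurd h1 ht.ne
      · exact ⟨i, h1 ▸ (hM i).sum_lt, h1.ge⟩
  refine ⟨i, h1, h2, fun u hu => ?_⟩
  rw [polyLine_eq hM i hu.1 (hu.2.trans h2), polyLine_eq hM i h1.le h2, add_assoc, ← add_smul]
  congr 2
  ring

/-- If the left segment at `t` has index `i` and the right one index `i'`, then either they agree
or `t` is the common vertex. -/
lemma segment_cases {q : ℕ → ℝ} (hq : StrictMono q) {i i' : ℕ} {t : ℝ} (h1 : q i < t)
    (h2 : t ≤ q (i + 1)) (h1' : q i' ≤ t) (h2' : t < q (i' + 1)) :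
    i' = i ∨ (i' = i + 1 ∧ t = q (i + 1)) := by
  have h3 : i < i' + 1 := hq.lt_iff_lt.1 (h1.trans h2')
  have h4 : i' ≤ i + 1 := hq.le_iff_le.1 (h1'.trans h2)
  obtain h | h : i' = i ∨ i' = i + 1 := by omega
  · exact .inl h
  · exact .inr ⟨h, le_antisymm h2 (h ▸ h1')⟩

include hM hq' in
theorem isNSystem_polyLine : IsNSystem n (Set.Ici (∑ j, A 0 j)) (polyLine A L) := by
  have h0 : 0 ≤ ∑ j, A 0 j := Finset.sum_nonneg fun j _ => ((hM 0).1 j).le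
  refine ⟨Set.Ici_subset_Ici.2 h0, Set.ordConnected_Ici, by simp, fun t ht => ?_⟩
  obtain ⟨i', h1', h2', hr⟩ := polyLine_right hM hq' ht
  have hval := polyLine_eq hM i' h1' h2'.le
  refine ⟨⟨fun j => ?_, ?_, ?_⟩, ?_⟩
  · rw [hval]
    simp only [Pi.add_apply, Pi.smul_apply, eVec_apply, smul_eq_mul]
    have := ((hM i').1 j).le
    simp only at this
    split_ifs <;> linarith
  · rw [hval]
    exact (hM i').monotone_segment (by linarith) (by simp only; linarith)
  · rw [hval, sum_add_smul_eVec]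
    ring
  · rcases (Set.mem_Ici.1 ht).lt_or_eq with hlt | heq
    · obtain ⟨i, h1, h2, hl⟩ := polyLine_left hM hq' hlt
      refine ⟨min (t - ∑ j, A i j) (∑ j, A (i' + 1) j - t),
        lt_min (by linarith) (by linarith), L (i' + 1), L (i + 1), fun u hu => hl u ⟨?_, hu.2.2⟩,
        fun u hu => hr u ⟨hu.2.1, ?_⟩, fun _ hlt' j hj1 hj2 => ?_⟩
      · have := hu.2.1
        have := min_le_left (t - ∑ j, A i j) (∑ j, A (i' + 1) j - t)
        linarith
      · have := hu.2.2
        have := min_le_right (t - ∑ j, A i j) (∑ j, A (i' + 1) j - t)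
        linarith
      · obtain rfl | ⟨rfl, rfl⟩ := segment_cases (strictMono_sum hM) h1 h2 h1' h2'
        · exact absurd hlt' (lt_irrefl _)
        · rw [polyLine_vertex hM]
          exact (hM (i + 1)).2.2.2.2.2.1 hlt' j hj1 hj2
    · refine ⟨∑ j, A (i' + 1) j - t, by linarith, L (i' + 1), L (i' + 1), fun u hu => ?_,
        fun u hu => hr u ⟨hu.2.1, by linarith [hu.2.2]⟩, fun _ h => absurd h (lt_irrefl _)⟩
      have : u = t := le_antisymm hu.2.2 (heq ▸ hu.1)
      simp [this]

include hM hq' in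
theorem isRigid_polyLine {δ : ℝ} (hΛ : ∀ y ∈ Λ, ∃ m : ℤ, y = δ * m) (hA : StrictMono (A 0))
    (hpos : 0 < ∑ j, A 0 j) :
    IsRigid n δ (Set.Ici (∑ j, A 0 j)) (polyLine A L) := by
  have key : ∀ t, IsSwitchNumber n (Set.Ici (∑ j, A 0 j)) (polyLine A L) t →
      ∃ i, t = ∑ j, A i j ∧ StrictMono (A i) := by
    rintro t ⟨ht, hf | ⟨hi, ε, hε, k, l, hkl, hl, hr⟩⟩
    · rw [frontier_Ici, Set.mem_singleton_iff] at hf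
      exact ⟨0, hf, hA⟩
    · rw [interior_Ici, Set.mem_Ioi] at hi
      obtain ⟨i', h1', h2', hr'⟩ := polyLine_right hM hq' ht
      obtain ⟨i, h1, h2, hl'⟩ := polyLine_left hM hq' hi
      have hk : k = L (i' + 1) := by
        set u := min (t + ε) (∑ j, A (i' + 1) j)
        have hu : t < u := lt_min (by linarith) h2'
        have e1 := hr u ⟨le_trans ht hu.le, hu.le, min_le_left _ _⟩
        have e2 := hr' u ⟨hu.le, min_le_right _ _⟩
        rw [e1] at e2
        exact eVec_inj_of_smul (sub_ne_zero.2 hu.ne') (add_left_cancel e2)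
      have hl2 : l = L (i + 1) := by
        set u := max (t - ε) (∑ j, A i j)
        have hu : u < t := max_lt (by linarith) h1
        have e1 := hl u ⟨le_trans ((strictMono_sum hM).monotone (Nat.zero_le i))
          (le_max_right _ _), le_max_left _ _, hu.le⟩
        have e2 := hl' u ⟨le_max_right _ _, hu.le⟩
        rw [e1] at e2
        exact eVec_inj_of_smul (sub_ne_zero.2 hu.ne) (add_left_cancel e2)
      obtain rfl | ⟨rfl, rfl⟩ := segment_cases (strictMono_sum hM) h1 h2 h1' h2'
      · exact absurd hkl (by rw [hk, hl2]; exact lt_irrefl _)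
      · exact ⟨i + 1, rfl, (hM (i + 1)).2.2.2.2.2.2 (by simpa [hk, hl2] using hkl)⟩
  refine ⟨⟨isNSystem_polyLine hM hq', isClosed_Ici, fun t ht => lt_of_lt_of_le hpos ht, ?_⟩, ?_⟩
  · intro t ht
    obtain ⟨i, rfl, hi⟩ := key t ht
    rw [polyLine_vertex hM]
    exact ⟨(hM i).1, hi⟩
  · intro t ht j
    obtain ⟨i, rfl, hi⟩ := key t ht
    rw [polyLine_vertex hM]
    exact hΛ _ ((hM i).2.1 j)

include hM hq' in
lemma polyLine_mem {t : ℝ} (ht : ∑ j, A 0 j ≤ t) : polyLine A L t ∈ C := by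
  obtain ⟨i, h1, h2, -⟩ := polyLine_right hM hq' ht
  rw [polyLine_eq hM i h1 h2.le]
  exact (hM i).mem (by linarith) (by simp only; linarith)

include hM hq' in
lemma polyLine_mul {N : ℝ} (hN : 0 < N) {m : ℕ}
    (hA : ∀ i, A (i + m) = N • A i) (hL : ∀ i, L (i + m) = L i) {t : ℝ}
    (ht : ∑ j, A 0 j ≤ t) : polyLine A L (N * t) = N • polyLine A L t := by
  obtain ⟨i, h1, h2, -⟩ := polyLine_right hM hq' ht
  have hs : ∀ i, ∑ j, A (i + m) j = N * ∑ j, A i j := fun i => by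
    rw [hA, Finset.mul_sum]; rfl
  have e : i + m + 1 = i + 1 + m := by omega
  rw [polyLine_eq hM i h1 h2.le, polyLine_eq hM (i + m), hs, hA, e, hL, smul_add, smul_smul, mul_sub]
  · rw [hs]; gcongr
  · rw [e, hs]; gcongr

end

end Polyline

section Loop

variable {n : ℕ}

lemma IsMove.smul {C : Set (RVec n)} (hC : ∀ c : ℝ, 0 < c → ∀ x ∈ C, c • x ∈ C) {Λ Λ' : Set ℝ}
    {x y : RVec n × Fin n} (h : IsMove n C Λ x y) {c : ℝ} (hc : 0 < c)
    (hΛ : ∀ j, c * x.1 j ∈ Λ') : IsMove n C Λ' (c • x.1, x.2) (c • y.1, y.2) := by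
  obtain ⟨h1, -, h3, h4, ⟨d, hd, he, hm⟩, h6, h7⟩ := h
  refine ⟨fun j => mul_pos hc (h1 j), hΛ, fun i j hij => ?_, fun i j hij => ?_,
    ⟨c * d, mul_pos hc hd, ?_, fun τ hτ => ?_⟩, fun hlt i hi hi' => ?_, fun hlt i j hij => ?_⟩
  · exact mul_le_mul_of_nonneg_left (h3 hij) hc.le
  · exact mul_le_mul_of_nonneg_left (h4 hij) hc.le
  · simp only [he, smul_add, smul_smul]
  · have := hC c hc _ (hm (τ / c) ⟨div_nonneg hτ.1 hc.le, by
      rw [div_le_iff₀ hc]; linarith [hτ.2, mul_comm c d]⟩)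
    rwa [smul_add, smul_smul, mul_div_cancel₀ _ hc.ne'] at this
  · exact congrArg (c * ·) (h6 hlt i hi hi')
  · exact mul_lt_mul_of_pos_left (h7 hlt hij) hc

lemma exists_common_multiple {ι : Type*} (s : Finset ι) (r : ι → ℚ) :
    ∃ D : ℕ, 0 < D ∧ ∀ i ∈ s, ∃ z : ℤ, (D : ℝ) * r i = z := by
  refine ⟨∏ i ∈ s, (r i).den, Finset.prod_pos fun i _ => (r i).den_pos, fun i hi => ?_⟩
  obtain ⟨k, hk⟩ := Finset.dvd_prod_of_mem (fun i => (r i).den) hi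
  refine ⟨k * (r i).num, ?_⟩
  rw [hk]
  have h := Rat.den_mul_eq_num (r i)
  have h' : ((r i).den : ℝ) * r i = (r i).num := by exact_mod_cast h
  push_cast
  rw [← h']
  ring

/-- A finite sequence of moves between points with coordinates in `δℚ`, leading from a point to an
integer multiple of it, closes up to a self-similar rigid system of mesh `δ`. -/
theorem exists_selfSimilar_of_loop (hn : 0 < n) {δ : ℝ} {C : Set (RVec n)}
    (hC : ∀ c : ℝ, 0 < c → ∀ x ∈ C, c • x ∈ C) {f : ℕ → RVec n × Fin n} {m N : ℕ} (hm : 0 < m)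
    (hN : 2 ≤ N) (hf : ∀ i < m, IsMove n C {y | ∃ r : ℚ, y = δ * r} (f i) (f (i + 1)))
    (hfm : f m = ((N : ℝ) • (f 0).1, (f 0).2)) (h0 : StrictMono (f 0).1) :
    ∃ (J : Set ℝ) (S : ℝ → RVec n), IsRigid n δ J S ∧ IsSelfSimilar n J S ∧
      (∀ t ∈ J, 0 < t ∧ S t ∈ C) ∧
      ∀ i < m, (∑ j, (f i).1 j)⁻¹ • (f i).1 ∈ FSet n J S := by
  have hr : ∀ i j, ∃ r : ℚ, i < m → (f i).1 j = δ * r := fun i j => by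
    by_cases h : i < m
    · obtain ⟨r, hr⟩ := (hf i h).2.1 j
      exact ⟨r, fun _ => hr⟩
    · exact ⟨0, fun h' => absurd h' h⟩
  choose r hr using hr
  obtain ⟨D, hD, hDr⟩ := exists_common_multiple (Finset.range m ×ˢ (Finset.univ : Finset (Fin n)))
    (fun p => r p.1 p.2)
  have hNpos : (0 : ℝ) < N := by exact_mod_cast (by omega : 0 < N)
  have hN1 : (1 : ℝ) < N := by exact_mod_cast (by omega : 1 < N)
  have hDpos : (0 : ℝ) < D := by exact_mod_cast hD
  set A : ℕ → RVec n := fun i => ((D : ℝ) * (N : ℝ) ^ (i / m)) • (f (i % m)).1 with hA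
  set L : ℕ → Fin n := fun i => (f (i % m)).2 with hL
  have hAm : ∀ i, A (i + m) = (N : ℝ) • A i := fun i => by
    simp only [hA, Nat.add_mod_right, Nat.add_div_right _ hm, smul_smul, pow_succ]
    congr 1
    ring
  have hLm : ∀ i, L (i + m) = L i := fun i => by simp [hL]
  have hM : ∀ i, IsMove n C {y | ∃ z : ℤ, y = δ * z} (A i, L i) (A (i + 1), L (i + 1)) := by
    intro i
    have hlt : i % m < m := Nat.mod_lt _ hm
    have hc : (0 : ℝ) < (D : ℝ) * (N : ℝ) ^ (i / m) := by positivity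
    have key := (hf _ hlt).smul hC hc (Λ' := {y | ∃ z : ℤ, y = δ * z}) (fun j => by
      obtain ⟨z, hz⟩ := hDr (i % m, j) (by simp [hlt])
      refine ⟨(N : ℤ) ^ (i / m) * z, ?_⟩
      rw [hr _ _ hlt]
      push_cast
      rw [← hz]
      ring)
    have e : ((((D : ℝ) * (N : ℝ) ^ (i / m)) • (f (i % m + 1)).1, (f (i % m + 1)).2) :
        RVec n × Fin n) = (A (i + 1), L (i + 1)) := by
      have hi := Nat.div_add_mod i m
      rcases (Nat.succ_le_of_lt hlt).lt_or_eq with h | h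
      · have h1 : (i + 1) % m = i % m + 1 := by
          rw [Nat.add_mod, Nat.mod_eq_of_lt (show 1 < m by omega), Nat.mod_eq_of_lt h]
        have h2 : (i + 1) / m = i / m := by
          rw [Nat.div_eq_iff hm]
          rw [mul_comm] at hi
          generalize i / m * m = a at *
          constructor <;> omega
        simp only [hA, hL, h1, h2]
      · have hi' : i + 1 = m * (i / m + 1) := by rw [mul_add]; omega
        have h1 : (i + 1) % m = 0 := by rw [hi']; simp
        have h2 : (i + 1) / m = i / m + 1 := by rw [hi']; exact Nat.mul_div_cancel_left _ hm
        simp only [hA, hL, h1, h2]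
        rw [show i % m + 1 = m from h, hfm]
        simp only [smul_smul, pow_succ, mul_assoc]
    exact e ▸ key
  have hA0 : A 0 = (D : ℝ) • (f 0).1 := by simp [hA]
  have hAk : ∀ i k, A (i + k * m) = (N : ℝ) ^ k • A i := fun i k => by
    induction k with
    | zero => simp
    | succ k ih => rw [Nat.succ_mul, ← add_assoc, hAm, ih, smul_smul, pow_succ']
  have hsk : ∀ i k, ∑ j, A (i + k * m) j = (N : ℝ) ^ k * ∑ j, A i j := fun i k => by
    rw [hAk, Finset.mul_sum]; rfl
  have hpos : ∀ i, 0 < ∑ j, A i j := fun i =>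
    have : Nonempty (Fin n) := ⟨⟨0, hn⟩⟩
    Finset.sum_pos (fun j _ => (hM i).1 j) Finset.univ_nonempty
  have hsub : ∀ i, Tendsto (fun k => ∑ j, A (i + k * m) j) atTop atTop := fun i => by
    simp only [hsk]
    exact (tendsto_pow_atTop_atTop_of_one_lt hN1).atTop_mul_const (hpos i)
  have hq' : Tendsto (fun i => ∑ j, A i j) atTop atTop := by
    refine tendsto_atTop_atTop_of_monotone (strictMono_sum hM).monotone fun b => ?_
    obtain ⟨k, hk⟩ := ((hsub 0).eventually_ge_atTop b).exists
    exact ⟨_, hk⟩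
  refine ⟨Set.Ici (∑ j, A 0 j), polyLine A L, isRigid_polyLine hM hq' (fun y hy => hy) ?_ (hpos 0),
    ⟨?_, N, hN1, fun t ht => ⟨?_, polyLine_mul hM hq' hNpos hAm hLm ht⟩⟩,
    fun t ht => ⟨lt_of_lt_of_le (hpos 0) ht, polyLine_mem hM hq' ht⟩, fun i hi => ?_⟩
  · rw [hA0]
    exact fun i j hij => mul_lt_mul_of_pos_left (h0 hij) hDpos
  · exact not_bddAbove_Ici _
  · have h1 := hpos 0
    have h2 := Set.mem_Ici.1 ht
    exact Set.mem_Ici.2 (by nlinarith)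
  · refine ⟨fun k => ∑ j, A (i + k * m) j, fun k => (strictMono_sum hM).monotone (Nat.zero_le _),
      fun k l hkl => strictMono_sum hM (by gcongr), hsub i, ?_⟩
    have hAi : A i = (D : ℝ) • (f i).1 := by
      simp [hA, Nat.mod_eq_of_lt hi, Nat.div_eq_of_lt hi]
    have : ∀ k, (∑ j, A (i + k * m) j)⁻¹ • polyLine A L (∑ j, A (i + k * m) j) =
        (∑ j, (f i).1 j)⁻¹ • (f i).1 := fun k => by
      rw [polyLine_vertex hM, hAk, hAi, smul_smul, smul_smul]
      simp only [Pi.smul_apply, smul_eq_mul, ← Finset.mul_sum]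
      congr 1
      have : ((N : ℝ) ^ k) ≠ 0 := by positivity
      field_simp
    simp only [this]
    exact tendsto_const_nhds

end Loop

section Walk

variable {α : Type*} {r : α → α → Prop}

/-- There is a finite sequence of `r`-steps from `x` to `y` passing through all points of `W`
before its last term. -/
def IsWalkThrough (r : α → α → Prop) (x y : α) (W : Set α) : Prop :=
  ∃ (f : ℕ → α) (m : ℕ), f 0 = x ∧ f m = y ∧ (∀ i < m, r (f i) (f (i + 1))) ∧
    ∀ w ∈ W, ∃ i < m, f i = w

lemma IsWalkThrough.refl (x : α) : IsWalkThrough r x x ∅ :=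
  ⟨fun _ => x, 0, rfl, rfl, by simp, by simp⟩

lemma IsWalkThrough.cons {x y z : α} {W : Set α} (hxy : r x y) (h : IsWalkThrough r y z W) :
    IsWalkThrough r x z (insert x W) := by
  obtain ⟨f, m, h0, hm, hf, hW⟩ := h
  refine ⟨fun i => Nat.casesOn i x f, m + 1, rfl, hm, fun i hi => ?_, fun w hw => ?_⟩
  · obtain _ | i := i
    · simpa [h0] using hxy
    · exact hf i (by omega)
  · obtain rfl | hw := hw
    · exact ⟨0, by omega, rfl⟩
    · obtain ⟨i, hi, rfl⟩ := hW w hw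
      exact ⟨i + 1, by omega, rfl⟩

lemma IsWalkThrough.mono {x y : α} {W W' : Set α} (hW : W' ⊆ W) (h : IsWalkThrough r x y W) :
    IsWalkThrough r x y W' := by
  obtain ⟨f, m, h0, hm, hf, h⟩ := h
  exact ⟨f, m, h0, hm, hf, fun w hw => h w (hW hw)⟩

lemma IsWalkThrough.trans {x y z : α} {W : Set α} (hxy : Relation.ReflTransGen r x y)
    (h : IsWalkThrough r y z W) : IsWalkThrough r x z W := by
  induction hxy using Relation.ReflTransGen.head_induction_on with
  | refl => exact h
  | head h1 _ ih => exact (ih.cons h1).mono (Set.subset_insert _ _)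

lemma IsWalkThrough.trans_insert {x y z : α} {W : Set α} (hxy : Relation.TransGen r x y)
    (h : IsWalkThrough r y z W) : IsWalkThrough r x z (insert x W) := by
  obtain ⟨w, h1, h2⟩ := Relation.TransGen.head'_iff.1 hxy
  exact (h.trans h2).cons h1

end Walk

section NSystem

variable {n : ℕ} {I : Set ℝ} {R : ℝ → RVec n}

/-- Induction backwards along an `n`-system, by linear steps of length at most `η`. -/
lemma IsNSystem.backward_induction (hR : IsNSystem n I R) {p q : ℝ} (hp : p ∈ I) (hq : q ∈ I)
    (hpq : p ≤ q) {η : ℝ} (hη : 0 < η) {Q : ℝ → Prop} (hQ : Q q)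
    (step : ∀ t t' (k : Fin n), p ≤ t → t < t' → t' ≤ q → t' - t ≤ η →
      (∀ u ∈ Set.Icc t t', R u = R t + (u - t) • eVec n k) → Q t' → Q t) : Q p := by
  obtain ⟨-, hI, -, hR⟩ := hR
  have hsub : Set.Icc p q ⊆ I := hI.out hp hq
  set T : Set ℝ := {t | t ∈ Set.Icc p q ∧ ∀ u ∈ Set.Icc t q, Q u} with hT
  have hqT : q ∈ T := ⟨⟨hpq, le_rfl⟩, fun u hu => by rwa [le_antisymm hu.2 hu.1]⟩
  have hbdd : BddBelow T := ⟨p, fun t ht => ht.1.1⟩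
  set s := sInf T with hs
  have hps : p ≤ s := le_csInf ⟨q, hqT⟩ fun t ht => ht.1.1
  have hsq : s ≤ q := csInf_le hbdd hqT
  obtain ⟨-, ε, hε, k, l, hl, hr, -⟩ := hR s (hsub ⟨hps, hsq⟩)
  have hup : ∀ u, s < u → u ≤ q → Q u := fun u hu huq => by
    obtain ⟨t, ht, htu⟩ := exists_lt_of_csInf_lt ⟨q, hqT⟩ hu
    exact ht.2 u ⟨htu.le, huq⟩
  have hQs : Q s := by
    rcases hsq.eq_or_lt with h | h
    · rwa [h]
    · set t' := min q (s + min ε η)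
      have h1 : s < t' := lt_min h (by linarith [lt_min hε hη])
      have h2 : t' ≤ s + min ε η := min_le_right _ _
      have h3 : t' ≤ q := min_le_left _ _
      refine step s t' k hps h1 h3 (by linarith [min_le_right ε η])
        (fun u hu => hr u ⟨hsub ⟨hps.trans hu.1, hu.2.trans h3⟩, hu.1, ?_⟩) (hup _ h1 h3)
      linarith [hu.2, min_le_left ε η]
  rcases hps.eq_or_lt with h | h
  · rwa [h]
  · exfalso
    set t := max p (s - min ε η)
    have h1 : t < s := max_lt h (by linarith [lt_min hε hη])
    have h2 : s - min ε η ≤ t := le_max_right _ _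
    have h3 : p ≤ t := le_max_left _ _
    have : t ∈ T := by
      refine ⟨⟨h3, h1.le.trans hsq⟩, fun u hu => ?_⟩
      rcases lt_trichotomy u s with hus | rfl | hus
      · have hmem : ∀ v ∈ Set.Icc u s, v ∈ I ∩ Set.Icc (s - ε) s := fun v hv =>
          ⟨hsub ⟨h3.trans (hu.1.trans hv.1), hv.2.trans hsq⟩,
            by linarith [hv.1, hu.1, min_le_left ε η], hv.2⟩
        refine step u s l (h3.trans hu.1) hus hsq
          (by linarith [hu.1, min_le_right ε η]) (fun v hv => ?_) hQs
        rw [hl v (hmem v hv), hl u (hmem u ⟨le_rfl, hus.le⟩), add_assoc, ← add_smul]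
        congr 2
        ring
      · exact hQs
      · exact hup u hus hu.2
    linarith [csInf_le hbdd this]

lemma linear_mono {t t' : ℝ} {k : Fin n} (h : R t' = R t + (t' - t) • eVec n k) (htt : t ≤ t')
    (j : Fin n) : R t j ≤ R t' j ∧ R t' j ≤ R t j + (t' - t) := by
  rw [h]
  simp only [Pi.add_apply, Pi.smul_apply, eVec_apply, smul_eq_mul]
  split_ifs <;> constructor <;> linarith

/-- The components of an `n`-system are nondecreasing. -/
lemma IsNSystem.apply_mono (hR : IsNSystem n I R) {p q : ℝ} (hp : p ∈ I) (hq : q ∈ I)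
    (hpq : p ≤ q) (j : Fin n) : R p j ≤ R q j := by
  refine hR.backward_induction hp hq hpq one_pos (Q := fun t => R t j ≤ R q j) le_rfl
    fun t t' k _ htt _ _ hlin h => ?_
  exact ((linear_mono (hlin t' ⟨htt.le, le_rfl⟩) htt.le j).1).trans h

/-- Slopes are compatible at a common point of two consecutive linear pieces. -/
lemma IsNSystem.slope_compat (hR : IsNSystem n I R) {t t' t'' : ℝ} (ht : t ∈ I) (ht'' : t'' ∈ I)
    (h1 : t < t') (h2 : t' < t'') {k k' : Fin n}
    (hk : ∀ u ∈ Set.Icc t t', R u = R t + (u - t) • eVec n k)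
    (hk' : ∀ u ∈ Set.Icc t' t'', R u = R t' + (u - t') • eVec n k') (hlt : k < k') (i : Fin n)
    (hi : k ≤ i) (hi' : i ≤ k') : R t' i = R t' k := by
  obtain ⟨-, hI, -, hR⟩ := hR
  have hsub : Set.Icc t t'' ⊆ I := hI.out ht ht''
  have hti : t' ∈ interior I :=
    interior_mono (Set.Ioo_subset_Icc_self.trans hsub) (by simpa using ⟨h1, h2⟩)
  obtain ⟨-, ε, hε, κ, l, hl, hr, h3⟩ := hR t' (interior_subset hti)
  have e1 : l = k := by
    set u := max t (t' - ε)
    have hu : u < t' := max_lt h1 (by linarith)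
    have hu1 : t ≤ u := le_max_left _ _
    have a1 := hl u ⟨hsub ⟨hu1, by linarith⟩, le_max_right _ _, hu.le⟩
    rw [hk u ⟨hu1, hu.le⟩, hk t' ⟨h1.le, le_rfl⟩, add_assoc] at a1
    refine eVec_inj_of_smul (sub_ne_zero.2 hu.ne) ?_
    have a2 := add_left_cancel a1
    rw [← sub_eq_iff_eq_add', ← sub_smul] at a2
    rw [← a2]
    congr 1
    ring
  have e2 : κ = k' := by
    set u := min t'' (t' + ε)
    have hu : t' < u := lt_min h2 (by linarith)
    have hu1 : u ≤ t'' := min_le_left _ _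
    have a1 := hr u ⟨hsub ⟨by linarith, hu1⟩, hu.le, min_le_right _ _⟩
    rw [hk' u ⟨hu.le, hu1⟩] at a1
    exact (eVec_inj_of_smul (sub_ne_zero.2 hu.ne') (add_left_cancel a1)).symm
  subst e1 e2
  exact h3 hti hlt i hi hi'

/-- The least index from which on all components of `R` are constant between `t` and `q`. -/
def frozenIdx (R : ℝ → RVec n) (q t : ℝ) : ℕ :=
  sInf {M | ∀ j : Fin n, M ≤ j → R t j = R q j}

lemma frozenIdx_spec (q t : ℝ) (j : Fin n) (hj : frozenIdx R q t ≤ j) : R t j = R q j :=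
  (Nat.sInf_mem (s := {M | ∀ j : Fin n, M ≤ j → R t j = R q j})
    ⟨n, fun j hj => absurd j.2 (not_lt.2 hj)⟩ : _) j hj

lemma frozenIdx_le {q t : ℝ} {M : ℕ} (h : ∀ j : Fin n, M ≤ j → R t j = R q j) :
    frozenIdx R q t ≤ M := Nat.sInf_le h

lemma frozenIdx_self (q : ℝ) : frozenIdx R q q = 0 :=
  Nat.le_zero.1 (frozenIdx_le fun _ _ => rfl)

lemma frozenIdx_le_dim (q t : ℝ) : frozenIdx R q t ≤ n :=
  frozenIdx_le fun j hj => absurd j.2 (not_lt.2 hj)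

section

variable (hR : IsNSystem n I R) {q t t' : ℝ} {k : Fin n} (ht' : t' ∈ I) (hq : q ∈ I)
  (htt : t < t') (htq : t' ≤ q) (hlin : R t' = R t + (t' - t) • eVec n k)

include hlin in
lemma linear_apply_of_ne {j : Fin n} (hj : j ≠ k) : R t' j = R t j := by
  rw [hlin]
  simp [eVec_apply, hj]

include hlin in
lemma linear_apply_self : R t' k = R t k + (t' - t) := by
  rw [hlin]
  simp [eVec_apply]

include hR ht' hq htt htq hlin in
lemma slope_lt_frozenIdx : (k : ℕ) < frozenIdx R q t := by
  by_contra! h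
  have h1 := frozenIdx_spec q t k h
  have h2 := hR.apply_mono ht' hq htq k
  have h3 := linear_apply_self hlin
  linarith

include hR ht' hq htt htq hlin in
lemma frozenIdx_linear_le : frozenIdx R q t' ≤ frozenIdx R q t := by
  have hk := slope_lt_frozenIdx hR ht' hq htt htq hlin
  refine frozenIdx_le fun j hj => ?_
  rw [linear_apply_of_ne hlin (by rintro rfl; omega)]
  exact frozenIdx_spec q t j hj

include hR ht' hq htt htq hlin in
lemma frozenIdx_eq_of_lt (h : frozenIdx R q t' < frozenIdx R q t) : frozenIdx R q t = k + 1 := by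
  have hk := slope_lt_frozenIdx hR ht' hq htt htq hlin
  have : frozenIdx R q t ≤ max (frozenIdx R q t') (k + 1) := by
    refine frozenIdx_le fun j hj => ?_
    rw [← linear_apply_of_ne hlin (by rintro rfl; omega)]
    exact frozenIdx_spec q t' j (by omega)
  omega

end

end NSystem

section Moves

variable {n : ℕ} {C : Set (RVec n)} {Λ : Set ℝ}

lemma add_smul_eVec_eq_update (s : RVec n) (i : Fin n) (τ : ℝ) :
    s + τ • eVec n i = Function.update s i (s i + τ) := by
  ext j
  rcases eq_or_ne j i with rfl | h
  · simp [eVec_apply]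
  · simp [eVec_apply, h]

lemma isMove_update {s : RVec n} {l i : Fin n} {w : ℝ} (hpos : ∀ j, 0 < s j) (hΛ : ∀ j, s j ∈ Λ)
    (hs : Monotone s) (hw : s i < w) (hw' : ∀ j, i < j → w ≤ s j)
    (htie : l < i → ∀ j, l ≤ j → j ≤ i → s j = s l) (hdrop : i < l → StrictMono s)
    (hC : ∀ τ, s i ≤ τ → τ ≤ w → Function.update s i τ ∈ C) :
    IsMove n C Λ (s, l) (Function.update s i w, i) := by
  refine ⟨hpos, hΛ, hs, fun a b hab => ?_, ⟨w - s i, by linarith, ?_, fun τ hτ => ?_⟩, htie, hdrop⟩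
  · rcases eq_or_ne a i with rfl | ha
    · rcases eq_or_ne b a with rfl | hb
      · exact le_rfl
      · simpa [hb] using hw' b (lt_of_le_of_ne hab hb.symm)
    · rcases eq_or_ne b i with rfl | hb
      · simpa [ha] using (hs hab).trans hw.le
      · simpa [ha, hb] using hs hab
  · simp only [add_smul_eVec_eq_update, add_sub_cancel]
  · simp only [add_smul_eVec_eq_update]
    exact hC _ (by linarith [hτ.1]) (by linarith [hτ.2])

/-- A particle starting in position `l` passes through the positions `l + 1, …, k` and ends
at height `v`. -/
lemma exists_pass {v : ℝ} {k : Fin n} (e : ℕ) :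
    ∀ (s : RVec n) (l' l : Fin n), (l : ℕ) + e = k → (∀ j, 0 < s j) → (∀ j, s j ∈ Λ) →
      Monotone s → (∀ i j, l ≤ i → i < j → j ≤ k → s i < s j) →
      (l' < l → ∀ j, l' ≤ j → j ≤ l → s j = s l') → (l < l' → StrictMono s) →
      s k < v → (∀ j, k < j → v ≤ s j) →
      (∀ p : RVec n, (∀ j, s j ≤ p j) → (∀ j, l ≤ j → j ≤ k → p j ≤ v) →
        (∀ j, j < l ∨ k < j → p j = s j) → p ∈ C) →
      ∃ s', Relation.TransGen (IsMove n C Λ) (s, l') (s', k) ∧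
        (∀ j, j < l ∨ k < j → s' j = s j) ∧ s' k = v ∧
        ∀ j j' : Fin n, l ≤ j → (j' : ℕ) = j + 1 → j' ≤ k → s' j = s j' := by
  induction e with
  | zero =>
    intro s l' l hl hpos hΛ hs _ htie hdrop hkv hvj hC
    obtain rfl : l = k := Fin.ext hl
    refine ⟨Function.update s l v, .single (isMove_update hpos hΛ hs hkv hvj htie hdrop
      fun τ h1 h2 => hC _ (fun j => ?_) (fun j hj hj' => ?_) (fun j hj => ?_)), fun j hj => ?_,
      by simp, fun j j' hj hj' hk => ?_⟩
    · rcases eq_or_ne j l with rfl | h <;> simp [*]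
    · obtain rfl := le_antisymm hj' hj
      simpa using h2
    · exact Function.update_of_ne (by rintro rfl; simp at hj) _ _
    · exact Function.update_of_ne (by rintro rfl; simp at hj) _ _
    · exfalso
      rw [Fin.le_def] at hj hk
      omega
  | succ e ih =>
    intro s l' l hl hpos hΛ hs hstrict htie hdrop hkv hvj hC
    obtain ⟨i, hi⟩ : ∃ i : Fin n, (i : ℕ) = l + 1 := ⟨⟨l + 1, by omega⟩, rfl⟩
    have hli : l < i := by rw [Fin.lt_def]; omega
    have hik : i ≤ k := by rw [Fin.le_def]; omega
    have hlt : ∀ j, l < j → i ≤ j := fun j hj => by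
      rw [Fin.lt_def] at hj; rw [Fin.le_def]; omega
    have hsli : s l < s i := hstrict l i le_rfl hli hik
    have hsk : s i ≤ s k := hs hik
    set s₁ := Function.update s l (s i) with hs₁
    have hs₁l : s₁ l = s i := by simp [hs₁]
    have hs₁j : ∀ j, j ≠ l → s₁ j = s j := fun j hj => by simp [hs₁, hj]
    have hle : ∀ j, s j ≤ s₁ j := fun j => by
      rcases eq_or_ne j l with rfl | h
      · rw [hs₁l]; exact hsli.le
      · rw [hs₁j j h]
    have hmove : IsMove n C Λ (s, l') (s₁, l) := by
      refine isMove_update hpos hΛ hs hsli (fun j hj => hs (hlt j hj)) htie hdrop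
        fun τ h1 h2 => hC _ (fun j => ?_) (fun j hj hj' => ?_) (fun j hj => ?_)
      · rcases eq_or_ne j l with rfl | h <;> simp [*]
      · rcases eq_or_ne j l with rfl | h
        · simp only [Function.update_self]; linarith
        · simp only [ne_eq, h, not_false_eq_true, Function.update_of_ne]
          linarith [hs hj']
      · refine Function.update_of_ne ?_ _ _
        rintro rfl
        rcases hj with hj | hj
        · exact lt_irrefl _ hj
        · exact absurd (hli.trans_le hik) hj.asymm
    obtain ⟨s', h1, h2, h3, h4⟩ := ih s₁ l i (by omega) (fun j => (hpos j).trans_le (hle j))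
      (fun j => by
        rcases eq_or_ne j l with rfl | h
        · rw [hs₁l]; exact hΛ i
        · rw [hs₁j j h]; exact hΛ j) hmove.2.2.2.1
      (fun a b ha hab hb => by
        rw [hs₁j a (hli.trans_le ha).ne', hs₁j b (hli.trans_le (ha.trans hab.le)).ne']
        exact hstrict a b (hli.le.trans ha) hab hb)
      (fun _ j hj hj' => by
        rcases hj.eq_or_lt with rfl | hj
        · rfl
        · rw [le_antisymm hj' (hlt j hj), hs₁l, hs₁j i hli.ne'])
      (fun h => absurd h hli.asymm) (by rw [hs₁j k (hli.trans_le hik).ne']; exact hkv)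
      (fun j hj => (hvj j hj).trans (hle j))
      (fun p hp hp' hpe => hC p (fun j => (hle j).trans (hp j)) (fun j hj hjk => by
        rcases hj.eq_or_lt with rfl | hj
        · rw [hpe l (.inl hli), hs₁l]; linarith
        · exact hp' j (hlt j hj) hjk) (fun j hj => by
        have hjl : j ≠ l := by
          rintro rfl
          rcases hj with hj | hj
          · exact lt_irrefl _ hj
          · exact absurd (hli.trans_le hik) hj.asymm
        rw [hpe j (hj.imp (fun h => h.trans hli) id), hs₁j j hjl]))
    refine ⟨s', .head hmove h1, fun j hj => ?_, h3, fun j j' hj hj' hk => ?_⟩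
    · have hjl : j ≠ l := by
        rintro rfl
        rcases hj with hj | hj
        · exact lt_irrefl _ hj
        · exact absurd (hli.trans_le hik) hj.asymm
      rw [h2 j (hj.imp (fun h => h.trans hli) id), hs₁j j hjl]
    · rcases hj.eq_or_lt with rfl | hj
      · rw [h2 l (.inl hli), hs₁l]
        congr 1
        exact Fin.ext (by omega)
      · rw [h4 j j' (hlt j hj) hj' hk, hs₁j j']
        rintro rfl
        rw [Fin.lt_def] at hj
        omega

end Moves

section Lift

variable {n : ℕ} {I : Set ℝ} {R : ℝ → RVec n} {b : RVec n} {q η β : ℝ} {C : Set (RVec n)}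
  {Λ : Set ℝ}

/-- The point `s` lies slightly above `R t` in its components of index less than `M`, while the
components of larger index, at which `R` no longer changes, have already reached the target `b`. -/
structure IsLift (R : ℝ → RVec n) (b : RVec n) (q η : ℝ) (Λ : Set ℝ) (M : ℕ) (t : ℝ)
    (s : RVec n) : Prop where
  mem : ∀ j, s j ∈ Λ
  strictMono : StrictMono fun j => s j - R t j
  pos : ∀ j, 0 < s j - R t j
  small : ∀ j : Fin n, (j : ℕ) < M → s j - R t j < η
  frozen : ∀ j : Fin n, M ≤ j → s j = b j ∧ R t j = R q j

/-- The target `b` lies in the lattice, above `R q`, with increasing shifts between `η` and `β`. -/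
structure IsTarget (R : ℝ → RVec n) (b : RVec n) (q η β : ℝ) (Λ : Set ℝ) : Prop where
  mem : ∀ j, b j ∈ Λ
  strictMono : StrictMono fun j => b j - R q j
  lower : ∀ j, η < b j - R q j
  upper : ∀ j, b j - R q j ≤ β

variable {M : ℕ} {t t' : ℝ} {s : RVec n}

lemma IsLift.strictMono_self (h : IsLift R b q η Λ M t s) (hR : Monotone (R t)) :
    StrictMono s := fun i j hij => by
  have h1 := h.strictMono hij
  have h2 := hR hij.le
  simp only at h1
  linarith

lemma IsLift.le (h : IsLift R b q η Λ M t s) (hb : IsTarget R b q η β Λ) (j : Fin n) :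
    s j - R t j ≤ β := by
  by_cases hj : (j : ℕ) < M
  · linarith [h.small j hj, hb.lower j, hb.upper j]
  · obtain ⟨h1, h2⟩ := h.frozen j (not_lt.1 hj)
    rw [h1, h2]
    exact hb.upper j

lemma IsLift.raise (h : IsLift R b q η Λ (M + 1) t s) (hb : IsTarget R b q η β Λ)
    (hR : Monotone (R t)) (hR0 : ∀ j, 0 ≤ R t j) {i l : Fin n} (hi : (i : ℕ) = M)
    (hRi : R t i = R q i) (hil : i ≤ l)
    (hC : ∀ p : RVec n, (∀ j, 0 ≤ p j - R t j ∧ p j - R t j ≤ β) → p ∈ C) :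
    IsMove n C Λ (s, l) (Function.update s i (b i), i) ∧
      IsLift R b q η Λ M t (Function.update s i (b i)) := by
  have hs := h.strictMono_self hR
  have hsi := h.small i (by omega)
  have hbi := hb.lower i
  have hbi' := hb.upper i
  have hfr : ∀ j, i < j → s j = b j ∧ R t j = R q j := fun j hj =>
    h.frozen j (by rw [Fin.lt_def] at hj; omega)
  constructor
  · refine isMove_update (fun j => by linarith [h.pos j, hR0 j]) h.mem hs.monotone (by linarith)
      (fun j hj => ?_) (fun hl => absurd hil (not_le.2 hl)) (fun _ => hs)
      (fun τ h1 h2 => hC _ fun j => ?_)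
    · obtain ⟨h1, h2⟩ := hfr j hj
      have h3 := hb.strictMono hj
      have h4 := hR hj.le
      simp only at h3
      linarith
    · rcases eq_or_ne j i with rfl | hj
      · simp only [Function.update_self]
        have := h.pos j
        constructor <;> linarith
      · simp only [ne_eq, hj, not_false_eq_true, Function.update_of_ne]
        exact ⟨(h.pos j).le, h.le hb j⟩
  · refine ⟨fun j => ?_, fun a c hac => ?_, fun j => ?_, fun j hj => ?_, fun j hj => ?_⟩
    · rcases eq_or_ne j i with rfl | hj
      · simpa using hb.mem j
      · simpa [hj] using h.mem j
    · rcases eq_or_ne a i with rfl | ha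
      · obtain ⟨h1, h2⟩ := hfr c hac
        simpa [hac.ne', h1, h2, hRi] using hb.strictMono hac
      · rcases eq_or_ne c i with rfl | hc
        · have h3 := h.small a (by rw [Fin.lt_def] at hac; omega)
          simp only [ne_eq, ha, not_false_eq_true, Function.update_of_ne, Function.update_self]
          linarith
        · simpa [ha, hc] using h.strictMono hac
    · rcases eq_or_ne j i with rfl | hj
      · simp only [Function.update_self]
        linarith [h.pos j]
      · simpa [hj] using h.pos j
    · have hji : j ≠ i := by rintro rfl; omega
      simpa [hji] using h.small j (by omega)
    · rcases eq_or_ne j i with rfl | hji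
      · simp [hRi]
      · have : (j : ℕ) ≠ i := fun h => hji (Fin.ext h)
        simpa [hji] using h.frozen j (by omega)

lemma IsLift.raise_all (hb : IsTarget R b q η β Λ) (hR : Monotone (R t)) (hR0 : ∀ j, 0 ≤ R t j)
    (hRq : ∀ j : Fin n, M ≤ j → R t j = R q j)
    (hC : ∀ p : RVec n, (∀ j, 0 ≤ p j - R t j ∧ p j - R t j ≤ β) → p ∈ C) (e : ℕ) :
    ∀ (s : RVec n) (l : Fin n), IsLift R b q η Λ (M + e + 1) t s → M + e ≤ (l : ℕ) →
      ∃ (s' : RVec n) (i : Fin n), (i : ℕ) = M ∧ Relation.ReflTransGen (IsMove n C Λ) (s, l) (s', i) ∧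
        IsLift R b q η Λ M t s' := by
  induction e with
  | zero =>
    intro s l h hl
    let i : Fin n := ⟨M, by omega⟩
    obtain ⟨h1, h2⟩ := h.raise hb hR hR0 (i := i) rfl (hRq i le_rfl) (l := l) hl hC
    exact ⟨_, i, rfl, .single h1, h2⟩
  | succ e ih =>
    intro s l h hl
    let i : Fin n := ⟨M + e + 1, by omega⟩
    obtain ⟨h1, h2⟩ := h.raise hb hR hR0 (i := i) rfl
      (hRq i (show M ≤ M + e + 1 by omega)) (l := l) hl hC
    obtain ⟨s', i', h3, h4, h5⟩ := ih _ i h2 (Nat.le_succ _)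
    exact ⟨s', i', h3, .head h1 h4, h5⟩

lemma IsLift.exists_height (h : IsLift R b q η Λ M t s)
    (hΛ : ∀ x y : ℝ, x < y → ∃ v ∈ Λ, x < v ∧ v < y) {k : Fin n} (hk : (k : ℕ) < M) (x : ℝ) :
    ∃ v ∈ Λ, s k - R t k < v - x ∧ v - x < η ∧ ∀ j, k < j → v - x < s j - R t j := by
  have hkη := h.small k hk
  by_cases hk1 : (k : ℕ) + 1 < n
  · set k' : Fin n := ⟨k + 1, hk1⟩
    have hkk' : k < k' := by rw [Fin.lt_def]; exact Nat.lt_succ_self _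
    have h1 := h.strictMono hkk'
    obtain ⟨v, hv, h2, h3⟩ := hΛ (s k - R t k + x) (min η (s k' - R t k') + x)
      (by gcongr; exact lt_min hkη h1)
    refine ⟨v, hv, by linarith, by linarith [min_le_left η (s k' - R t k')], fun j hj => ?_⟩
    have h4 : k' ≤ j := hj
    have h5 := h.strictMono.monotone h4
    linarith [min_le_right η (s k' - R t k')]
  · obtain ⟨v, hv, h2, h3⟩ := hΛ (s k - R t k + x) (η + x) (by linarith)
    refine ⟨v, hv, by linarith, by linarith, fun j hj => ?_⟩
    rw [Fin.lt_def] at hj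
    omega

lemma IsLift.advance (h : IsLift R b q η Λ M t s) (hR : Monotone (R t)) (hR0 : ∀ j, 0 ≤ R t j)
    (hR' : Monotone (R t')) (hΛ : ∀ x y : ℝ, x < y → ∃ v ∈ Λ, x < v ∧ v < y) {k l : Fin n}
    (htt : t < t') (hη : t' - t ≤ η) (hlin : R t' = R t + (t' - t) • eVec n k)
    (hk : (k : ℕ) < M) (htie : l < k → ∀ i, l ≤ i → i ≤ k → R t i = R t l)
    (hC : ∀ p : RVec n, (∀ j, 0 ≤ p j - R t j) → (∀ j, p j - R t j ≤ 2 * η ∨ p j = s j) →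
      p ∈ C) :
    ∃ s', Relation.TransGen (IsMove n C Λ) (s, l) (s', k) ∧ IsLift R b q η Λ M t' s' := by
  obtain ⟨v, hv, hv1, hv2, hv3⟩ := h.exists_height hΛ hk (R t' k)
  have hs := h.strictMono_self hR
  have hself := linear_apply_self hlin
  have hne : ∀ j, j ≠ k → R t' j = R t j := fun j hj => linear_apply_of_ne hlin hj
  have hpos : ∀ j, 0 < s j := fun j => by linarith [h.pos j, hR0 j]
  obtain ⟨l₀, hl₀k, htie₀, hl₀, hl₀'⟩ : ∃ l₀ ≤ k, (∀ i, l₀ ≤ i → i ≤ k → R t i = R t k) ∧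
      l₀ ≤ l ∧ (l₀ < l → l₀ = k) := by
    rcases lt_or_ge l k with hlk | hlk
    · exact ⟨l, hlk.le, fun i hi hi' => by rw [htie hlk i hi hi', htie hlk k hlk.le le_rfl],
        le_rfl, fun h => absurd h (lt_irrefl _)⟩
    · exact ⟨k, le_rfl, fun i hi hi' => by rw [le_antisymm hi hi'], hlk, fun _ => rfl⟩
  obtain ⟨s', h1, h2, h3, h4⟩ := exists_pass (C := C) (Λ := Λ) (v := v) (k := k) (k - l₀) s l l₀
    (by rw [Fin.le_def] at hl₀k; omega) hpos h.mem hs.monotone (fun i j _ hij _ => hs hij)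
    (fun hlt => absurd hl₀ (not_le.2 hlt)) (fun _ => hs) (by linarith) (fun j hj => by
      have h5 := hv3 j hj
      have h6 := hR' hj.le
      rw [hne j hj.ne'] at h6
      linarith) (fun p hp hp' hpe => hC p (fun j => by linarith [hp j, h.pos j]) fun j => by
      by_cases hj : l₀ ≤ j ∧ j ≤ k
      · left
        rw [htie₀ j hj.1 hj.2]
        linarith [hp' j hj.1 hj.2]
      · right
        refine hpe j ?_
        by_contra! hcon
        exact hj hcon)
  have hmid : ∀ j, l₀ ≤ j → j < k → ∃ j' : Fin n, (j' : ℕ) = j + 1 ∧ j < j' ∧ j' ≤ k ∧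
      s' j - R t' j = s j' - R t j' := fun j hj hjk => by
    rw [Fin.lt_def] at hjk
    set j' : Fin n := ⟨j + 1, by omega⟩ with hj'
    have hjk' : j' ≤ k := by rw [Fin.le_def]; exact hjk
    have hjj' : j < j' := by rw [Fin.lt_def]; exact Nat.lt_succ_self _
    refine ⟨j', rfl, hjj', hjk', ?_⟩
    rw [h4 j j' hj rfl hjk', hne j (hjj'.trans_le hjk').ne, htie₀ j hj (hjj'.le.trans hjk'),
      htie₀ j' (hj.trans hjj'.le) hjk']
  have hout : ∀ j, j < l₀ ∨ k < j → s' j - R t' j = s j - R t j := fun j hj => by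
    rw [h2 j hj, hne]
    rintro rfl
    rcases hj with hj | hj
    · exact absurd hl₀k (not_le.2 hj)
    · exact lt_irrefl _ hj
  have htri : ∀ j, (j < l₀ ∨ k < j) ∨ (l₀ ≤ j ∧ j < k) ∨ j = k := fun j => by
    rcases lt_trichotomy j k with hj | hj | hj
    · rcases lt_or_ge j l₀ with hj' | hj'
      · exact .inl (.inl hj')
      · exact .inr (.inl ⟨hj', hj⟩)
    · exact .inr (.inr hj)
    · exact .inl (.inr hj)
  have hlow : ∀ j, s j - R t j ≤ s' j - R t' j ∧
      (l₀ ≤ j → j ≤ k → s j - R t j < s' j - R t' j) := fun j => by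
    rcases htri j with hj | ⟨hj1, hj2⟩ | rfl
    · refine ⟨(hout j hj).ge, fun h5 h6 => ?_⟩
      rcases hj with hj | hj
      · exact absurd h5 (not_le.2 hj)
      · exact absurd h6 (not_le.2 hj)
    · obtain ⟨j', -, h6, -, h8⟩ := hmid j hj1 hj2
      have : s j - R t j < s' j - R t' j := by rw [h8]; exact h.strictMono h6
      exact ⟨this.le, fun _ _ => this⟩
    · rw [h3]
      exact ⟨hv1.le, fun _ _ => hv1⟩
  refine ⟨s', h1, fun j => ?_, fun a c hac => ?_, fun j => (h.pos j).trans_le (hlow j).1,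
    fun j hj => ?_, fun j hj => ?_⟩
  · rcases htri j with hj | ⟨hj1, hj2⟩ | rfl
    · rw [h2 j hj]; exact h.mem j
    · have hjk := hj2
      rw [Fin.lt_def] at hj2
      rw [h4 j ⟨j + 1, by omega⟩ hj1 rfl (Fin.le_def.2 hj2)]
      exact h.mem _
    · rw [h3]; exact hv
  · change s' a - R t' a < s' c - R t' c
    rcases htri a with ha | ⟨ha1, ha2⟩ | rfl
    · rw [hout a ha]
      exact (h.strictMono hac).trans_le (hlow c).1
    · obtain ⟨a', h5, h6, h7, h8⟩ := hmid a ha1 ha2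
      rw [h8]
      have hac' : a' ≤ c := by rw [Fin.lt_def] at hac; rw [Fin.le_def]; omega
      rcases le_or_gt c k with hck | hck
      · exact (h.strictMono.monotone hac').trans_lt ((hlow c).2 (ha1.trans hac.le) hck)
      · exact (h.strictMono (h7.trans_lt hck)).trans_le (hlow c).1
    · rw [h3]
      exact (hv3 c hac).trans_le (hlow c).1
  · rcases htri j with hj' | ⟨hj1, hj2⟩ | rfl
    · rw [hout j hj']; exact h.small j hj
    · obtain ⟨j', -, -, h7, h8⟩ := hmid j hj1 hj2
      rw [h8]
      rw [Fin.le_def] at h7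
      exact h.small j' (by omega)
    · rw [h3]; exact hv2
  · have hkj : k < j := by rw [Fin.lt_def]; omega
    rw [h2 j (.inr hkj), hne j hkj.ne']
    exact h.frozen j hj

/-- An `n`-system on `[p, q]` starting with slope of index `0` is followed, from any small lift of
its initial point, by a walk of moves leading to the target `b`. -/
theorem exists_walk (hn : 0 < n) (hR : IsNSystem n I R) {p : ℝ} (hp : p ∈ I) (hq : q ∈ I)
    (hpq : p < q) (hη : 0 < η) (hb : IsTarget R b q η β Λ) (hηβ : 2 * η ≤ β)
    (hΛ : ∀ x y : ℝ, x < y → ∃ v ∈ Λ, x < v ∧ v < y) {V : RVec n → ℝ → Prop}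
    (hC : ∀ t ∈ Set.Icc p q, ∀ x : RVec n,
      (∀ j, 0 ≤ x j - R t j ∧ x j - R t j ≤ if frozenIdx R q t < n then β else 2 * η) →
      x ∈ C ∧ ∀ u ∈ Set.Icc t q, u ≤ t + η → V x u)
    {p' : ℝ} (hpp' : p < p')
    (hp' : ∀ u ∈ I ∩ Set.Icc p p', R u = R p + (u - p) • eVec n (⟨0, hn⟩ : Fin n))
    (hs : IsLift R b q η Λ (frozenIdx R q p) p s) :
    ∃ W, IsWalkThrough (IsMove n C Λ) (s, ⟨0, hn⟩) (b, ⟨0, hn⟩) W ∧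
      ∀ u ∈ Set.Ico p q, ∃ w ∈ W, V w.1 u := by
  have hsub : Set.Icc p q ⊆ I := hR.2.1.out hp hq
  have hmono : ∀ t ∈ Set.Icc p q, Monotone (R t) := fun t ht => (hR.2.2.2 t (hsub ht)).1.2.1
  have hnn : ∀ t ∈ Set.Icc p q, ∀ j, 0 ≤ R t j := fun t ht => (hR.2.2.2 t (hsub ht)).1.1
  have main : ∀ (s : RVec n) (l : Fin n), IsLift R b q η Λ (frozenIdx R q p) p s →
      (∀ t' ≤ q, p < t' → ∀ k : Fin n,
        (∀ u ∈ Set.Icc p t', R u = R p + (u - p) • eVec n k) →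
        l < k → ∀ i, l ≤ i → i ≤ k → R p i = R p l) → (p = q → l = ⟨0, hn⟩) →
      ∃ W, IsWalkThrough (IsMove n C Λ) (s, l) (b, ⟨0, hn⟩) W ∧
        ∀ u ∈ Set.Ico p q, ∃ w ∈ W, V w.1 u := by
    refine hR.backward_induction hp hq hpq.le hη (Q := fun t =>
      ∀ (s : RVec n) (l : Fin n), IsLift R b q η Λ (frozenIdx R q t) t s →
      (∀ t' ≤ q, t < t' → ∀ k : Fin n,
        (∀ u ∈ Set.Icc t t', R u = R t + (u - t) • eVec n k) →
        l < k → ∀ i, l ≤ i → i ≤ k → R t i = R t l) → (t = q → l = ⟨0, hn⟩) →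
      ∃ W, IsWalkThrough (IsMove n C Λ) (s, l) (b, ⟨0, hn⟩) W ∧
        ∀ u ∈ Set.Ico t q, ∃ w ∈ W, V w.1 u) ?_ ?_
    · intro s l hs _ hl
      obtain rfl : s = b := funext fun j => (hs.frozen j (by simp [frozenIdx_self])).1
      rw [hl rfl]
      exact ⟨∅, IsWalkThrough.refl _, by simp⟩
    · intro t t' k hpt htt htq hη' hlin ih s l hs htie _
      have ht : t ∈ Set.Icc p q := ⟨hpt, htt.le.trans htq⟩
      have ht' : t' ∈ Set.Icc p q := ⟨hpt.trans htt.le, htq⟩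
      have hlin' := hlin t' ⟨htt.le, le_rfl⟩
      have hk := slope_lt_frozenIdx hR (hsub ht') hq htt htq hlin'
      have hnear : ∀ x : RVec n, (∀ j, 0 ≤ x j - R t j) →
          (∀ j, x j - R t j ≤ 2 * η ∨ x j = s j) →
          x ∈ C ∧ ∀ u ∈ Set.Icc t q, u ≤ t + η → V x u := fun x h1 h2 => by
        refine hC t ht x fun j => ⟨h1 j, ?_⟩
        split_ifs with hfr
        · rcases h2 j with h2 | h2
          · linarith
          · rw [h2]; exact hs.le hb j
        · rcases h2 j with h2 | h2
          · exact h2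
          · have := hs.small j (by omega)
            rw [h2]; linarith
      have hVs : ∀ u ∈ Set.Ico t t', V s u := fun u hu =>
        (hnear s (fun j => (hs.pos j).le) fun j => .inr rfl).2 u ⟨hu.1, hu.2.le.trans htq⟩
          (by linarith [hu.2])
      obtain ⟨s₁, h1, h2⟩ := hs.advance (C := C) (hmono t ht) (hnn t ht) (hmono t' ht') hΛ htt hη'
        hlin' hk (htie t' htq htt k hlin) fun x h1 h2 => (hnear x h1 h2).1
      suffices hsuff : ∃ s₂ l₂, Relation.ReflTransGen (IsMove n C Λ) (s₁, k) (s₂, l₂) ∧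
          ∃ W, IsWalkThrough (IsMove n C Λ) (s₂, l₂) (b, ⟨0, hn⟩) W ∧
            ∀ u ∈ Set.Ico t' q, ∃ w ∈ W, V w.1 u by
        obtain ⟨s₂, l₂, h3, W, h4, h5⟩ := hsuff
        refine ⟨insert (s, l) W, h4.trans_insert (h1.trans_left h3), fun u hu => ?_⟩
        rcases lt_or_ge u t' with h | h
        · exact ⟨_, Set.mem_insert _ _, hVs u ⟨hu.1, h⟩⟩
        · obtain ⟨w, hw, hwu⟩ := h5 u ⟨h, hu.2⟩
          exact ⟨w, Set.mem_insert_of_mem _ hw, hwu⟩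
      rcases (frozenIdx_linear_le hR (hsub ht') hq htt htq hlin').eq_or_lt with heq | hlt
      · refine ⟨s₁, k, .refl, ih s₁ k (heq ▸ h2) (fun t'' ht''q ht't'' k' hlin'' hkk' i hi hi' =>
          hR.slope_compat (hsub ht) (hsub ⟨ht'.1.trans ht't''.le, ht''q⟩) htt ht't'' hlin hlin''
            hkk' i hi hi') fun htq' => ?_⟩
        rw [htq', frozenIdx_self] at heq
        omega
      · have hidx := frozenIdx_eq_of_lt hR (hsub ht') hq htt htq hlin' hlt
        have hfr : frozenIdx R q t' < n := hlt.trans_le (frozenIdx_le_dim q t)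
        obtain ⟨e, he⟩ : ∃ e, (k : ℕ) = frozenIdx R q t' + e := Nat.exists_eq_add_of_le (by omega)
        obtain ⟨s₂, i, hi, h3, h4⟩ := IsLift.raise_all (C := C) (M := frozenIdx R q t') hb
          (hmono t' ht') (hnn t' ht') (fun j hj => frozenIdx_spec q t' j hj)
          (fun x hx => (hC t' ht' x (by simpa [hfr] using hx)).1) e s₁ k
          (by rwa [← he, ← hidx]) he.ge
        refine ⟨s₂, i, h3, ih s₂ i h4 (fun t'' ht''q ht't'' k' hlin'' hik' => ?_) fun htq' => ?_⟩
        · have := slope_lt_frozenIdx hR (hsub ⟨ht'.1.trans ht't''.le, ht''q⟩) hq ht't'' ht''q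
            (hlin'' t'' ⟨ht't''.le, le_rfl⟩)
          rw [Fin.lt_def] at hik'
          omega
        · rw [htq', frozenIdx_self] at hi
          exact Fin.ext hi
  refine main s ⟨0, hn⟩ hs (fun t' ht'q hpt' k hlin hk => ?_) fun _ => rfl
  exfalso
  set u := min p' t'
  have hu : p < u := lt_min hpp' hpt'
  have hut' : u ≤ t' := min_le_right _ _
  have e := hp' u ⟨hsub ⟨hu.le, hut'.trans ht'q⟩, hu.le, min_le_left _ _⟩
  rw [hlin u ⟨hu.le, hut'⟩] at e
  have := eVec_inj_of_smul (sub_ne_zero.2 hu.ne') (add_left_cancel e)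
  exact absurd this hk.ne'

end Lift

section Accumulation

variable {n : ℕ} {I : Set ℝ} {R : ℝ → RVec n}

lemma IsNSystem.sum_apply (hR : IsNSystem n I R) {q : ℝ} (hq : q ∈ I) : ∑ j, R q j = q :=
  (hR.2.2.2 q hq).1.2.2

lemma IsNSystem.apply_nonneg (hR : IsNSystem n I R) {q : ℝ} (hq : q ∈ I) (j : Fin n) :
    0 ≤ R q j :=
  (hR.2.2.2 q hq).1.1 j

lemma IsNSystem.apply_le (hR : IsNSystem n I R) {q : ℝ} (hq : q ∈ I) (j : Fin n) : R q j ≤ q := by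
  conv_rhs => rw [← hR.sum_apply hq]
  exact Finset.single_le_sum (fun i _ => hR.apply_nonneg hq i) (Finset.mem_univ j)

lemma IsNSystem.apply_sub_le (hR : IsNSystem n I R) {p q : ℝ} (hp : p ∈ I) (hq : q ∈ I)
    (hpq : p ≤ q) (j : Fin n) : R q j - R p j ≤ q - p := by
  conv_rhs => rw [← hR.sum_apply hp, ← hR.sum_apply hq, ← Finset.sum_sub_distrib]
  exact Finset.single_le_sum (f := fun i => R q i - R p i)
    (fun i _ => sub_nonneg.2 (hR.apply_mono hp hq hpq i)) (Finset.mem_univ j)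

lemma IsNSystem.le_mul_of_frozenIdx_lt (hR : IsNSystem n I R) {t q : ℝ} (ht : t ∈ I) (hq : q ∈ I)
    (h : frozenIdx R q t < n) : q ≤ n * t := by
  let i : Fin n := ⟨n - 1, by omega⟩
  have hi : R t i = R q i := frozenIdx_spec q t i (show frozenIdx R q t ≤ n - 1 by omega)
  calc q = ∑ j, R q j := (hR.sum_apply hq).symm
    _ ≤ ∑ _j : Fin n, R q i := Finset.sum_le_sum fun j _ =>
      (hR.2.2.2 q hq).1.2.1 (show (j : ℕ) ≤ n - 1 by omega)
    _ = n * R t i := by simp [hi]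
    _ ≤ n * t := by gcongr; exact hR.apply_le ht i

lemma IsNSystem.inv_smul_mem_Icc (hR : IsNSystem n I R) {q : ℝ} (hq : q ∈ I) :
    q⁻¹ • R q ∈ Set.Icc (0 : RVec n) 1 := by
  have h0 : 0 ≤ q := hR.1 hq
  refine ⟨fun j => ?_, fun j => ?_⟩
  · simpa using mul_nonneg (inv_nonneg.2 h0) (hR.apply_nonneg hq j)
  · simpa [inv_mul_eq_div] using div_le_one_of_le₀ (hR.apply_le hq j) h0

/-- Along points of `I` satisfying `Q` that go to infinity, `q⁻¹ • R q` accumulates somewhere. -/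
lemma IsNSystem.exists_tendsto (hR : IsNSystem n I R) {Q : ℝ → Prop}
    (h : ∀ T, ∃ u ∈ I, T ≤ u ∧ Q u) :
    ∃ (x : RVec n) (q : ℕ → ℝ), (∀ i, q i ∈ I) ∧ (∀ i, Q (q i)) ∧ StrictMono q ∧
      Tendsto q atTop atTop ∧ Tendsto (fun i => (q i)⁻¹ • R (q i)) atTop (𝓝 x) := by
  choose g hgI hgT hgQ using h
  let q : ℕ → ℝ := fun i => Nat.rec (g 0) (fun _ t => g (t + 1)) i
  have hq : ∀ i, q i + 1 ≤ q (i + 1) := fun i => hgT _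
  have hqm : StrictMono q := strictMono_nat_of_lt_succ fun i => by linarith [hq i]
  have hqi : ∀ i : ℕ, (i : ℝ) ≤ q i := fun i => by
    induction i with
    | zero => exact Nat.cast_zero.trans_le (hgT 0)
    | succ i ih => push_cast; linarith [hq i]
  have hqt : Tendsto q atTop atTop := tendsto_atTop_mono hqi tendsto_natCast_atTop_atTop
  have hqI : ∀ i, q i ∈ I ∧ Q (q i) := fun i => by cases i <;> exact ⟨hgI _, hgQ _⟩
  obtain ⟨x, -, φ, hφ, hx⟩ := isCompact_Icc.tendsto_subseq
    fun i => hR.inv_smul_mem_Icc (hqI i).1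
  exact ⟨x, q ∘ φ, fun i => (hqI _).1, fun i => (hqI _).2, hqm.comp hφ,
    hqt.comp hφ.tendsto_atTop, hx⟩

lemma IsNSystem.exists_forall_near (hR : IsNSystem n I R) {ε : ℝ} (hε : 0 < ε) :
    ∃ T, ∀ u ∈ I, T ≤ u → ∃ x ∈ FSet n I R, dist (u⁻¹ • R u) x ≤ ε := by
  by_contra! hcon
  obtain ⟨x, q, hqI, hq, hqm, hqt, hx⟩ := hR.exists_tendsto hcon
  obtain ⟨i, hi⟩ := (hx.eventually (Metric.ball_mem_nhds x hε)).exists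
  exact lt_asymm (hq i x ⟨q, hqI, hqm, hqt, hx⟩) hi

lemma IsNSystem.FSet_subset (hR : IsNSystem n I R) : FSet n I R ⊆ Set.Icc 0 1 := by
  rintro x ⟨q, hqI, -, -, hx⟩
  exact isClosed_Icc.mem_of_tendsto hx (.of_forall fun i => hR.inv_smul_mem_Icc (hqI i))

lemma IsNSystem.exists_forall_FSet_near (hR : IsNSystem n I R) {ε : ℝ} (hε : 0 < ε) (T : ℝ) :
    ∃ T', ∀ x ∈ FSet n I R, ∃ u ∈ I, T ≤ u ∧ u < T' ∧ dist (u⁻¹ • R u) x ≤ ε := by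
  obtain ⟨Y, hYF, hY, hcov⟩ := Metric.finite_approx_of_totallyBounded
    (isCompact_Icc.totallyBounded.subset hR.FSet_subset) (ε / 2) (half_pos hε)
  have : ∀ y : RVec n, ∃ u, y ∈ Y → u ∈ I ∧ T ≤ u ∧ dist (u⁻¹ • R u) y < ε / 2 := fun y => by
    by_cases hy : y ∈ Y
    · obtain ⟨q, hqI, -, hqt, hq⟩ := hYF hy
      obtain ⟨i, h1, h2⟩ := ((hqt.eventually_ge_atTop T).and
        (hq.eventually (Metric.ball_mem_nhds y (half_pos hε)))).exists
      exact ⟨q i, fun _ => ⟨hqI i, h1, h2⟩⟩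
    · exact ⟨0, fun h => absurd h hy⟩
  choose u hu using this
  obtain ⟨T', hT'⟩ := (hY.image u).bddAbove
  refine ⟨T' + 1, fun x hx => ?_⟩
  obtain ⟨y, hy, hxy⟩ := Set.mem_iUnion₂.1 (hcov hx)
  obtain ⟨h1, h2, h3⟩ := hu y hy
  refine ⟨u y, h1, h2, (hT' (Set.mem_image_of_mem u hy)).trans_lt (lt_add_one _), ?_⟩
  linarith [dist_triangle ((u y)⁻¹ • R (u y)) y x, Metric.mem_ball'.1 hxy]

/-- A proper `n`-system has slope of index `0` to the right of arbitrarily large points. -/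
lemma IsProperSys.exists_slope_zero (hn : 0 < n) (hR : IsProperSys n I R) (T : ℝ) :
    ∃ u ∈ I, T ≤ u ∧ ∃ p' > u, ∀ t ∈ I ∩ Set.Icc u p',
      R t = R u + (t - u) • eVec n (⟨0, hn⟩ : Fin n) := by
  obtain ⟨hR, hunb⟩ := hR
  let z : Fin n := ⟨0, hn⟩
  by_contra! hcon
  obtain ⟨p, hp, hTp⟩ := hunb T
  have hTp : T ≤ p := (hTp z).le.trans (hR.apply_le hp z)
  obtain ⟨q, hq, hpq⟩ := hunb (R p z)
  have hpq := hpq z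
  have hlt : p ≤ q := by
    by_contra! h
    exact absurd (hR.apply_mono hq hp h.le z) (not_le.2 hpq)
  refine absurd (hR.backward_induction hp hq hlt one_pos (Q := fun t => R t z = R q z) rfl
    fun t t' k hpt htt htq _ hlin h => ?_) hpq.ne
  have ht : t ∈ I := hR.2.1.out hp hq ⟨hpt, htt.le.trans htq⟩
  rcases eq_or_ne z k with rfl | hzk
  · obtain ⟨u, hu, hu'⟩ := hcon t ht (hTp.trans hpt) t' htt
    exact absurd (hlin u hu.2) hu'
  · rw [← h, linear_apply_of_ne (hlin t' ⟨htt.le, le_rfl⟩) hzk]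

lemma dist_normalize_le {x y : RVec n} {u κ : ℝ} (hu : 0 < u) (hx : ∀ j, 0 ≤ x j)
    (hx0 : 0 < ∑ j, x j) (hy : ∑ j, y j = u) (h : ∀ j, |x j - y j| ≤ κ * u) (hκ : 0 ≤ κ) :
    dist ((∑ j, x j)⁻¹ • x) (u⁻¹ • y) ≤ (n + 1) * κ := by
  set s := ∑ j, x j with hs
  have hsu : |u - s| ≤ n * (κ * u) := by
    rw [abs_sub_comm, hs, ← hy, ← Finset.sum_sub_distrib]
    refine (Finset.abs_sum_le_sum_abs _ _).trans ((Finset.sum_le_sum fun j _ => h j).trans ?_)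
    simp [hy]
  refine (dist_pi_le_iff (by positivity)).2 fun j => ?_
  have hxs : x j ≤ s := Finset.single_le_sum (fun i _ => hx i) (Finset.mem_univ j)
  have e : s⁻¹ * x j - u⁻¹ * y j = x j / s * ((u - s) / u) + (x j - y j) / u := by
    field_simp
    ring
  rw [Real.dist_eq]
  simp only [Pi.smul_apply, smul_eq_mul]
  rw [e]
  refine (abs_add_le _ _).trans ?_
  rw [abs_mul, abs_div (u - s), abs_div (x j - y j), abs_of_pos hu,
    abs_of_nonneg (div_nonneg (hx j) hx0.le)]
  have h1 : x j / s ≤ 1 := div_le_one_of_le₀ hxs hx0.le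
  have h2 : |u - s| / u ≤ n * κ := by rw [div_le_iff₀ hu]; linarith
  have h3 : |x j - y j| / u ≤ κ := by rw [div_le_iff₀ hu]; exact h j
  have h4 : x j / s * (|u - s| / u) ≤ 1 * (n * κ) :=
    mul_le_mul h1 h2 (by positivity) zero_le_one
  linarith

/-- When `R p` and `R q` have nearly the same direction and `q` is much larger than `p`, a suitable
small lift of `R p` has an integer multiple that is a target above `R q`. -/
lemma exists_lift_target {Λ : Set ℝ} (hΛ : ∀ x y : ℝ, x < y → ∃ v ∈ Λ, x < v ∧ v < y)
    (hΛN : ∀ (N : ℕ), ∀ v ∈ Λ, (N : ℝ) * v ∈ Λ) {p q θ μ : ℝ} (hp : 0 < p) (hθ : 0 < θ)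
    (hθ1 : θ ≤ 1) (hμ : 12 * (n + 1) * μ = θ) (hpq : p ≤ μ * q)
    (hRp : ∀ j, 0 ≤ R p j ∧ R p j ≤ p) (hclose : ∀ j, |R p j / p - R q j / q| ≤ 2 * μ) :
    ∃ (a : RVec n) (N : ℕ), 2 ≤ N ∧ IsLift R ((N : ℝ) • a) q (θ * p) Λ n p a ∧
      IsTarget R ((N : ℝ) • a) q (θ * p) (3 * θ * q) Λ := by
  have hn : (0 : ℝ) ≤ n := n.cast_nonneg
  have hμ0 : 0 < μ := by
    by_contra! h
    nlinarith
  have hμθ : 12 * μ ≤ θ := by nlinarith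
  have hq : 0 < q := by
    by_contra! h
    nlinarith
  have hpq' : p ≤ q := by nlinarith
  obtain ⟨g, hg⟩ : ∃ g, g = 6 * μ * p := ⟨_, rfl⟩
  have hg0 : 0 < g := by rw [hg]; positivity
  have hgθ : g * (2 * (n + 1)) = θ * p := by rw [hg, ← hμ]; ring
  have hex : ∀ j : Fin n, ∃ v ∈ Λ, R p j + g * (2 * j + 1) < v ∧ v < R p j + g * (2 * j + 2) :=
    fun j => hΛ _ _ (by nlinarith)
  choose a haΛ ha1 ha2 using hex
  have hj : ∀ j : Fin n, (j : ℝ) + 1 ≤ n := fun j => by exact_mod_cast j.2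
  have ha0 : ∀ j, g < a j - R p j := fun j => by
    have := mul_nonneg hg0.le (j : ℕ).cast_nonneg (α := ℝ)
    linarith [ha1 j]
  have haη : ∀ j, a j - R p j < θ * p := fun j => by
    have := mul_le_mul_of_nonneg_left (hj j) hg0.le
    linarith [ha2 j]
  have hagap : ∀ i j, i < j → g < (a j - R p j) - (a i - R p i) := fun i j hij => by
    have h1 : (i : ℝ) + 1 ≤ j := by exact_mod_cast hij
    have := mul_le_mul_of_nonneg_left h1 hg0.le
    linarith [ha1 j, ha2 i]
  set N := ⌈q / p⌉₊ with hN
  have hN1 : q ≤ N * p := (div_le_iff₀ hp).1 (Nat.le_ceil _)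
  have hN2 : N * p ≤ q + p := by
    have := (Nat.ceil_lt_add_one (div_pos hq hp).le).le
    rw [← hN] at this
    calc N * p ≤ (q / p + 1) * p := by gcongr
      _ = q + p := by field_simp
  have hN3 : 2 ≤ N := by
    have : (2 : ℝ) ≤ N := by
      refine le_trans ((le_div_iff₀ hp).2 ?_) (Nat.le_ceil _)
      nlinarith
    exact_mod_cast this
  have hNg : 6 * μ * q ≤ N * g := by
    rw [hg]
    nlinarith
  have hE : ∀ j, |N * R p j - R q j| ≤ 3 * μ * q := fun j => by
    have e : N * R p j - R q j
        = (N * p - q) * (R p j / p) + q * (R p j / p - R q j / q) := by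
      field_simp
      ring
    have h1 : R p j / p ≤ 1 := div_le_one_of_le₀ (hRp j).2 hp.le
    have h2 : 0 ≤ R p j / p := div_nonneg (hRp j).1 hp.le
    rw [e]
    refine (abs_add_le _ _).trans ?_
    rw [abs_mul, abs_mul, abs_of_pos hq, abs_of_nonneg h2, abs_of_nonneg (by linarith)]
    have h3 := mul_le_mul_of_nonneg_left (hclose j) hq.le
    have h4 := mul_le_mul (show N * p - q ≤ p by linarith) h1 h2 hp.le
    linarith
  have hb : ∀ j, ((N : ℝ) • a) j - R q j = N * (a j - R p j) + (N * R p j - R q j) := fun j => by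
    simp only [Pi.smul_apply, smul_eq_mul]
    ring
  have hN0 : (0 : ℝ) < N := by positivity
  have hNc : ∀ j, N * g < N * (a j - R p j) := fun j => mul_lt_mul_of_pos_left (ha0 j) hN0
  refine ⟨a, N, hN3, ⟨haΛ, fun i j hij => ?_, fun j => hg0.trans (ha0 j), fun j _ => haη j,
    fun j hj => absurd j.2 (not_lt.2 hj)⟩, ⟨fun j => hΛN N _ (haΛ j), fun i j hij => ?_,
    fun j => ?_, fun j => ?_⟩⟩
  · change a i - R p i < a j - R p j
    linarith [hagap i j hij]
  · change ((N : ℝ) • a) i - R q i < ((N : ℝ) • a) j - R q j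
    rw [hb, hb]
    have := mul_lt_mul_of_pos_left (hagap i j hij) hN0
    linarith [abs_le.1 (hE i), abs_le.1 (hE j)]
  · rw [hb]
    have h1 : θ * p ≤ 1 * p := by gcongr
    have : 0 < μ * q := by positivity
    linarith [hNc j, abs_le.1 (hE j)]
  · rw [hb]
    have h1 : N * (a j - R p j) ≤ N * (θ * p) := mul_le_mul_of_nonneg_left (haη j).le hN0.le
    have h2 : θ * (N * p) ≤ θ * (2 * q) :=
      mul_le_mul_of_nonneg_left (by linarith) hθ.le
    have h3 : 12 * μ * q ≤ θ * q := by gcongr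
    have h4 : 0 < θ * q := by positivity
    linarith [abs_le.1 (hE j)]

/-- A system whose directions stay near `F` and accumulate near every point of `F` is close
to `F`. -/
lemma cubeDist_le {F : Set (RVec n)} {J : Set ℝ} {S : ℝ → RVec n} {ε : ℝ} (hε : 0 < ε)
    (hS : ∀ t ∈ J, ∃ x ∈ F, dist (t⁻¹ • S t) x ≤ ε / 2)
    (hF : ∀ x ∈ F, ∃ y ∈ FSet n J S, dist x y ≤ ε) : cubeDist n F (FSet n J S) ≤ ε := by
  have key : ∀ x y : RVec n, dist x y ≤ ε → x - y ∈ cubeNbhd n ε := fun x y h j =>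
    ((dist_pi_le_iff hε.le).1 h j : dist (x j) (y j) ≤ ε)
  refine csInf_le ⟨0, fun _ h => h.1.le⟩ ⟨hε, fun x hx => ?_, ?_⟩
  · obtain ⟨y, hy, hxy⟩ := hF x hx
    exact ⟨y, hy, x - y, key x y hxy, add_sub_cancel _ _⟩
  · rintro y ⟨t, htJ, -, -, ht⟩
    obtain ⟨i, hi⟩ := (ht.eventually (Metric.ball_mem_nhds y (half_pos hε))).exists
    obtain ⟨x, hx, hxt⟩ := hS (t i) (htJ i)
    refine ⟨x, hx, y - x, key y x ?_, add_sub_cancel _ _⟩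
    linarith [dist_triangle_left y x ((t i)⁻¹ • S (t i)), Metric.mem_ball.1 hi]

end Accumulation

/-- **Theorem (approximation by self-similar systems).** For any proper `n`-system `R`
and any `δ > 0`, `ε > 0`, there is a self-similar rigid `n`-system `S` of mesh `δ`
with `dist(F(R), F(S)) ≤ ε`. -/
theorem approx_by_self_similar (n : ℕ) (hn : 2 ≤ n)
    (I : Set ℝ) (R : ℝ → RVec n) (hR : IsProperSys n I R)
    (δ ε : ℝ) (hδ : 0 < δ) (hε : 0 < ε) :
    ∃ (J : Set ℝ) (S : ℝ → RVec n),
      IsRigid n δ J S ∧ IsSelfSimilar n J S ∧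
      cubeDist n (FSet n I R) (FSet n J S) ≤ ε := by
  have hn0 : 0 < n := by omega
  have hn' : (0 : ℝ) < n := by exact_mod_cast hn0
  have hsys := hR.1
  have hε4 : 0 < ε / 4 := by linarith
  set κ := min 1 (ε / (4 * (n + 1)))
  have hκ0 : 0 < κ := lt_min one_pos (by positivity)
  have hκ1 : κ ≤ 1 := min_le_left _ _
  have hκε : (n + 1) * κ ≤ ε / 4 :=
    calc (n + 1) * κ ≤ (n + 1) * (ε / (4 * (n + 1))) := by gcongr; exact min_le_right _ _
      _ = ε / 4 := by field_simp
  set θ := κ / (3 * n) with hθ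
  have hθ0 : 0 < θ := by positivity
  have hθκ : 3 * n * θ = κ := by rw [hθ]; field_simp
  have hn2 : (2 : ℝ) ≤ n := by exact_mod_cast hn
  have hθκ' : 6 * θ ≤ κ := by rw [← hθκ]; nlinarith
  set μ := θ / (12 * (n + 1)) with hμ
  have hμ0 : 0 < μ := by positivity
  have hμθ : 12 * (n + 1) * μ = θ := by rw [hμ]; field_simp
  obtain ⟨T, hT⟩ := hsys.exists_forall_near hε4
  obtain ⟨x₀, u, huI, huz, -, hut, hux⟩ := hsys.exists_tendsto (hR.exists_slope_zero hn0)
  have hnear := hux.eventually (Metric.ball_mem_nhds x₀ hμ0)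
  obtain ⟨i, hiT, hi0, hix⟩ :=
    ((hut.eventually_ge_atTop T).and ((hut.eventually_gt_atTop 0).and hnear)).exists
  set p := u i
  have hp : p ∈ I := huI i
  obtain ⟨T', hT'⟩ := hsys.exists_forall_FSet_near hε4 p
  obtain ⟨i', hiT', hi0', hix'⟩ := ((hut.eventually_ge_atTop T').and
    ((hut.eventually_ge_atTop (p / μ)).and hnear)).exists
  set q := u i'
  have hq : q ∈ I := huI i'
  have hpμq : p ≤ μ * q := by rwa [div_le_iff₀' hμ0] at hi0'
  have hμn : n * μ < 1 / 2 := by nlinarith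
  have hpq : p < q := by
    by_contra! h
    nlinarith
  have hclose : ∀ j, |R p j / p - R q j / q| ≤ 2 * μ := fun j => by
    have h1 : dist (p⁻¹ • R p) (q⁻¹ • R q) ≤ 2 * μ := by
      linarith [dist_triangle_right (p⁻¹ • R p) (q⁻¹ • R q) x₀, Metric.mem_ball.1 hix,
        Metric.mem_ball.1 hix']
    have h2 := (dist_pi_le_iff (by positivity)).1 h1 j
    simpa [Real.dist_eq, inv_mul_eq_div] using h2
  set Λ : Set ℝ := {y | ∃ r : ℚ, y = δ * r}
  have hΛd : ∀ x y : ℝ, x < y → ∃ v ∈ Λ, x < v ∧ v < y := fun x y hxy => by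
    obtain ⟨r, h1, h2⟩ := exists_rat_btwn (div_lt_div_of_pos_right hxy hδ)
    exact ⟨δ * r, ⟨r, rfl⟩, (div_lt_iff₀' hδ).1 h1, (lt_div_iff₀' hδ).1 h2⟩
  have hΛN : ∀ (N : ℕ), ∀ v ∈ Λ, (N : ℝ) * v ∈ Λ := by
    rintro N _ ⟨r, rfl⟩
    exact ⟨N * r, by push_cast; ring⟩
  obtain ⟨a, N, hN, ha, hb⟩ := exists_lift_target hΛd hΛN hi0 hθ0 (by linarith) hμθ hpμq
    (fun j => ⟨hsys.apply_nonneg hp j, hsys.apply_le hp j⟩) hclose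
  have hfr : frozenIdx R q p = n := (frozenIdx_le_dim q p).eq_of_not_lt fun h => by
    have h1 := hsys.le_mul_of_frozenIdx_lt hp hq h
    have h2 : n * p ≤ n * (μ * q) := by gcongr
    nlinarith
  set C : Set (RVec n) :=
    {x | 0 < ∑ j, x j ∧ ∃ y ∈ FSet n I R, dist ((∑ j, x j)⁻¹ • x) y ≤ ε / 2}
  have hCsmul : ∀ c : ℝ, 0 < c → ∀ x ∈ C, c • x ∈ C := by
    rintro c hc x ⟨hx, y, hy, hxy⟩
    have e : ∑ j, (c • x) j = c * ∑ j, x j := by simp [Finset.mul_sum]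
    refine ⟨by rw [e]; positivity, y, hy, ?_⟩
    rwa [e, smul_smul, mul_inv, mul_right_comm, inv_mul_cancel₀ hc.ne', one_mul]
  have hmem : ∀ t ∈ Set.Icc p q, t ∈ I := fun t ht => hsys.2.1.out hp hq ht
  obtain ⟨p', hpp', hp'⟩ := huz i
  obtain ⟨W, ⟨f, m, hf0, hfm, hf, hfW⟩, hW⟩ := exists_walk (C := C)
    (V := fun x u => dist ((∑ j, x j)⁻¹ • x) (u⁻¹ • R u) ≤ ε / 4) hn0 hsys hp hq hpq
    (mul_pos hθ0 hi0) hb (by nlinarith) hΛd (fun t ht x hx => by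
      have ht0 : 0 < t := hi0.trans_le ht.1
      have hxt : ∀ j, x j - R t j ≤ κ * t := fun j => by
        refine (hx j).2.trans ?_
        split_ifs with h
        · have h1 := hsys.le_mul_of_frozenIdx_lt (hmem t ht) hq h
          have h2 : 3 * θ * q ≤ 3 * θ * (n * t) := by gcongr
          linarith [congrArg (· * t) hθκ]
        · have h1 : θ * p ≤ θ * t := by gcongr; exact ht.1
          nlinarith
      have hx0 : ∀ j, 0 ≤ x j := fun j => by
        linarith [(hx j).1, hsys.apply_nonneg (hmem t ht) j]
      have hxs : 0 < ∑ j, x j := ht0.trans_le <| by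
        conv_lhs => rw [← hsys.sum_apply (hmem t ht)]
        exact Finset.sum_le_sum fun j _ => sub_nonneg.1 (hx j).1
      have hV : ∀ u ∈ Set.Icc t q, u ≤ t + θ * p →
          dist ((∑ j, x j)⁻¹ • x) (u⁻¹ • R u) ≤ ε / 4 := fun u hu hut => by
        have huI : u ∈ I := hmem u ⟨ht.1.trans hu.1, hu.2⟩
        refine (dist_normalize_le (ht0.trans_le hu.1) hx0 hxs (hsys.sum_apply huI)
          (fun j => abs_le.2 ?_) hκ0.le).trans hκε
        have h1 := hsys.apply_mono (hmem t ht) huI hu.1 j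
        have h2 := hsys.apply_sub_le (hmem t ht) huI hu.1 j
        have h3 : κ * t ≤ κ * u := by gcongr; exact hu.1
        have h4 : θ * p ≤ κ * u := by
          have : p ≤ u := ht.1.trans hu.1
          gcongr
          linarith
        constructor <;> linarith [(hx j).1, hxt j]
      refine ⟨⟨hxs, ?_⟩, hV⟩
      obtain ⟨y, hy, hyt⟩ := hT t (hmem t ht) (hiT.trans ht.1)
      refine ⟨y, hy, ?_⟩
      have := hV t ⟨le_rfl, ht.2⟩ (by linarith [mul_pos hθ0 hi0])
      linarith [dist_triangle ((∑ j, x j)⁻¹ • x) (t⁻¹ • R t) y])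
    hpp' hp' (by rwa [hfr])
  have hm : 0 < m := by
    obtain ⟨w, hw, -⟩ := hW p ⟨le_rfl, hpq⟩
    obtain ⟨i, hi, -⟩ := hfW w hw
    exact (Nat.zero_le i).trans_lt hi
  obtain ⟨J, S, hrigid, hself, hSC, hSF⟩ := exists_selfSimilar_of_loop hn0 hCsmul hm hN hf
    (by rw [hfm, hf0])
    (by rw [hf0]; exact ha.strictMono_self (hsys.2.2.2 p hp).1.2.1)
  refine ⟨J, S, hrigid, hself, cubeDist_le hε (fun t ht => ?_) fun x hx => ?_⟩
  · obtain ⟨-, -, h⟩ := hSC t ht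
    rwa [hrigid.1.1.sum_apply ht] at h
  · obtain ⟨u, -, hpu, huT', hux⟩ := hT' x hx
    obtain ⟨w, hw, hwu⟩ := hW u ⟨hpu, huT'.trans_le hiT'⟩
    obtain ⟨i, hi, rfl⟩ := hfW w hw
    refine ⟨_, hSF i hi, ?_⟩
    linarith [dist_triangle_left x ((∑ j, (f i).1 j)⁻¹ • (f i).1) (u⁻¹ • R u),
      dist_comm ((∑ j, (f i).1 j)⁻¹ • (f i).1) (u⁻¹ • R u)]
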